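/- arXiv:1711.03588 — 11 statements merged into one kernel-verified Lean document; each statement's English description precedes it below -/
import Mathlib

section
/- New variant rule for almost-sure termination (Theorem 4.2, stochastic-process form): Let (Y_n)_{n∈ℕ} be an adapted process of nonnegative, integrable, real-valued random variables, let p : (0,∞) → ℝ be antitone with 0 < p(r) ≤ 1 for all r > 0, and let d : (0,∞) → ℝ be antitone with d(r) > 0 for all r > 0. Suppose that for every n ∈ ℕ, almost surely on the event {Y_n > 0}: (i) E[Y_{n+1} ∣ ℱ_n] ≤ Y_n (the super-martingale condition), and (ii) ℙ(Y_{n+1} ≤ Y_n − d(Y_n) ∣ ℱ_n) ≥ p(Y_n) (the progress condition). Then almost surely there exists n with Y_n = 0. -/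
open MeasureTheory Filter

open scoped Topology

/-- A nonnegative supermartingale converges almost surely. -/
lemma ae_exists_tendsto_of_supermartingale_nonneg {Ω : Type*} {m : MeasurableSpace Ω}
    {μ : Measure Ω} [IsFiniteMeasure μ] {ℱ : Filtration ℕ m} {Z : ℕ → Ω → ℝ}
    (hZ : Supermartingale Z ℱ μ) (hnonneg : ∀ n ω, 0 ≤ Z n ω) :
    ∀ᵐ ω ∂μ, ∃ c, Tendsto (fun n => Z n ω) atTop (𝓝 c) := by
  have hbdd : ∀ n, eLpNorm ((-Z) n) 1 μ ≤ (∫ ω, Z 0 ω ∂μ).toNNReal := by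
    intro n
    rw [Pi.neg_apply, eLpNorm_neg, eLpNorm_one_eq_lintegral_enorm,
      ← ofReal_integral_norm_eq_lintegral_enorm (hZ.integrable n)]
    refine ENNReal.ofReal_le_ofReal ?_
    simp_rw [Real.norm_of_nonneg (hnonneg n _)]
    simpa using hZ.setIntegral_le (Nat.zero_le n) MeasurableSet.univ
  filter_upwards [hZ.neg.exists_ae_tendsto_of_bdd hbdd] with ω ⟨c, hc⟩
  exact ⟨-c, by simpa using hc.neg⟩

/-- A nonnegative process satisfying the supermartingale inequality as long as it is positive
converges almost surely on the event that it stays positive. -/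
lemma ae_exists_tendsto_of_condExp_le_of_pos {Ω : Type*} {m : MeasurableSpace Ω}
    {μ : Measure Ω} [IsFiniteMeasure μ] {ℱ : Filtration ℕ m} {Y : ℕ → Ω → ℝ}
    (hadp : Adapted ℱ Y) (hnonneg : ∀ n ω, 0 ≤ Y n ω) (hint : ∀ n, Integrable (Y n) μ)
    (hsuper : ∀ n, ∀ᵐ ω ∂μ, 0 < Y n ω → (μ[Y (n + 1) | ℱ n]) ω ≤ Y n ω) :
    ∀ᵐ ω ∂μ, (∀ n, 0 < Y n ω) → ∃ c, Tendsto (fun n => Y n ω) atTop (𝓝 c) := by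
  let A : ℕ → Set Ω := fun n => {ω | ∀ k ≤ n, 0 < Y k ω}
  have hA : ∀ n, MeasurableSet[ℱ n] (A n) := by
    intro n
    have : A n = ⋂ k, ⋂ (_ : k ≤ n), {ω | 0 < Y k ω} := by ext; simp [A]
    rw [this]
    exact MeasurableSet.iInter fun k => MeasurableSet.iInter fun hk =>
      ℱ.mono hk _ (hadp k measurableSet_Ioi)
  let Z : ℕ → Ω → ℝ := fun n => (A n).indicator (Y n)
  have hZ_succ : ∀ n, Z (n + 1) = (A n).indicator (Y (n + 1)) := by
    intro n
    ext ω
    by_cases h : ω ∈ A n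
    · by_cases h' : ω ∈ A (n + 1)
      · simp [Z, h, h']
      · have h0 : ¬ 0 < Y (n + 1) ω := fun hpos => h' fun k hk => by
          rcases Nat.le_succ_iff.1 hk with hk | rfl
          exacts [h k hk, hpos]
        simp [Z, h, h', le_antisymm (not_lt.1 h0) (hnonneg _ _)]
    · have h' : ω ∉ A (n + 1) := fun h' => h fun k hk => h' k (hk.trans n.le_succ)
      simp [Z, h, h']
  have hZ : Supermartingale Z ℱ μ := by
    refine supermartingale_nat (fun n => (hadp.stronglyAdapted n).indicator (hA n))
      (fun n => (hint n).indicator (ℱ.le n _ (hA n))) fun n => ?_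
    rw [hZ_succ]
    filter_upwards [condExp_indicator (hint (n + 1)) (hA n), hsuper n] with ω h₁ h₂
    rw [h₁]
    exact Set.indicator_le_indicator' fun h => h₂ (h n le_rfl)
  filter_upwards [ae_exists_tendsto_of_supermartingale_nonneg hZ
    fun n ω => Set.indicator_nonneg (fun ω _ => hnonneg n ω) ω] with ω ⟨c, hc⟩ hpos
  refine ⟨c, hc.congr fun n => ?_⟩
  have h : ω ∈ A n := fun k _ => hpos k
  simp [Z, h]

/-- A function that is antitone on the positive reals is measurable once it is made constant on
the nonpositive ones. -/
lemma measurable_ite_of_antitone_pos {d : ℝ → ℝ}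
    (hd : ∀ x y : ℝ, 0 < x → x ≤ y → d y ≤ d x) (c : ℝ) :
    Measurable fun x : ℝ => if x ≤ 0 then c else d x := by
  have hexp : Measurable fun x => d (Real.exp x) :=
    Antitone.measurable fun x y hxy => hd _ _ (Real.exp_pos x) (Real.exp_le_exp.2 hxy)
  have h : (fun x : ℝ => if x ≤ 0 then c else d x) =
      fun x => if x ≤ 0 then c else d (Real.exp (Real.log x)) := by
    ext x
    split_ifs with hx
    · rfl
    · rw [Real.exp_log (not_le.1 hx)]
  rw [h]
  exact Measurable.ite measurableSet_Iic measurable_const (hexp.comp Real.measurable_log)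

/-- A convergent real sequence cannot infinitely often decrease by a fixed positive amount. -/
lemma not_frequently_le_sub_of_tendsto {u : ℕ → ℝ} {c ε : ℝ} (hu : Tendsto u atTop (𝓝 c))
    (hε : 0 < ε) : ¬ ∃ᶠ n in atTop, u (n + 1) ≤ u n - ε := by
  have h : Tendsto (fun n => u n - u (n + 1)) atTop (𝓝 0) := by
    simpa using hu.sub (hu.comp (tendsto_add_atTop_nat 1))
  rw [not_frequently]
  filter_upwards [h.eventually_lt_const hε] with n hn
  linarith

/-- New variant rule for almost-sure termination (Theorem 4.2,
stochastic-process form). -/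
theorem stmt_0 {Ω : Type*} {m : MeasurableSpace Ω} {μ : Measure Ω} [IsProbabilityMeasure μ]
    (ℱ : Filtration ℕ m) (Y : ℕ → Ω → ℝ)
    (hadp : Adapted ℱ Y)
    (hnonneg : ∀ n ω, 0 ≤ Y n ω)
    (hint : ∀ n, Integrable (Y n) μ)
    (p d : ℝ → ℝ)
    (hp_pos : ∀ r : ℝ, 0 < r → 0 < p r)
    (hp_le_one : ∀ r : ℝ, 0 < r → p r ≤ 1)
    (hp_anti : ∀ x y : ℝ, 0 < x → x ≤ y → p y ≤ p x)
    (hd_pos : ∀ r : ℝ, 0 < r → 0 < d r)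
    (hd_anti : ∀ x y : ℝ, 0 < x → x ≤ y → d y ≤ d x)
    -- super-martingale condition on {Y n > 0}
    (hsuper : ∀ n, ∀ᵐ ω ∂μ, 0 < Y n ω → (μ[Y (n + 1) | ℱ n]) ω ≤ Y n ω)
    -- progress condition on {Y n > 0}
    (hprog : ∀ n, ∀ᵐ ω ∂μ, 0 < Y n ω →
      p (Y n ω) ≤
        (μ[Set.indicator {ω' | Y (n + 1) ω' ≤ Y n ω' - d (Y n ω')} (fun _ => (1 : ℝ)) |
          ℱ n]) ω) :
    ∀ᵐ ω ∂μ, ∃ n, Y n ω = 0 := by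
  let s : ℕ → Set Ω := fun n => {ω | Y n ω ≤ Y (n - 1) ω - d (Y (n - 1) ω)}
  have hs : ∀ n, MeasurableSet[ℱ n] (s n) := by
    intro n
    have hprev : Measurable[ℱ n] (Y (n - 1)) := (hadp (n - 1)).mono (ℱ.mono (n.sub_le 1)) le_rfl
    have hd : Measurable[ℱ n] fun ω => d (Y (n - 1) ω) := by
      convert (measurable_ite_of_antitone_pos hd_anti (d 0)).comp hprev using 1
      ext ω
      by_cases h : Y (n - 1) ω ≤ 0
      · simp [le_antisymm h (hnonneg _ _)]
      · simp [h]
    exact measurableSet_le (hadp n) (hprev.sub hd)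
  filter_upwards [ae_exists_tendsto_of_condExp_le_of_pos hadp hnonneg hint hsuper,
    ae_mem_limsup_atTop_iff μ hs, ae_all_iff.2 hprog] with ω hconv hlevy hprogω
  by_contra! hne
  have hpos : ∀ n, 0 < Y n ω := fun n => (hnonneg n ω).lt_of_ne' (hne n)
  obtain ⟨c, hc⟩ := hconv hpos
  obtain ⟨H, hH⟩ := hc.bddAbove_range
  have hYH : ∀ n, Y n ω ≤ H := fun n => hH ⟨n, rfl⟩
  have hHpos : 0 < H := (hpos 0).trans_le (hYH 0)
  have hmem : ω ∈ limsup s atTop := by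
    refine hlevy.2 (tendsto_atTop_mono (fun n => ?_)
      (tendsto_natCast_atTop_atTop.atTop_mul_const (hp_pos H hHpos)))
    calc (n : ℝ) * p H = ∑ _k ∈ Finset.range n, p H := by simp
      _ ≤ _ := Finset.sum_le_sum fun k _ =>
        (hp_anti _ _ (hpos k) (hYH k)).trans (hprogω k (hpos k))
  rw [← limsup_nat_add s 1, mem_limsup_iff_frequently_mem] at hmem
  refine not_frequently_le_sub_of_tendsto hc (hd_pos H hHpos) (hmem.mono fun n hn => ?_)
  have hn : Y (n + 1) ω ≤ Y n ω - d (Y n ω) := hn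
  linarith [hd_anti _ _ (hpos n) (hYH n)]
end

section
/- Bounded integer variant rule (Theorem 3.3, stochastic-process form): Let (Y_n)_{n∈ℕ} be an adapted process of integer-valued random variables, let τ be a stopping time, let Low ≤ High be fixed integers, and let ε ∈ (0,1] be a fixed real. Suppose that for every n ∈ ℕ, almost surely on the event {n < τ}: Low < Y_n ≤ High and ℙ(Y_{n+1} < Y_n ∣ ℱ_n) ≥ ε. Then ℙ(τ < ∞) = 1. -/
open MeasureTheory Filter

/-- If the conditional expectation of `g` is at least `ε` wherever the bounded, nonnegative,
`m'`-measurable weight `f` does not vanish, then `ε ∫ f ≤ ∫ f g`. -/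
theorem mul_integral_le_integral_mul_of_le_condExp {Ω : Type*} {m' m : MeasurableSpace Ω}
    {μ : Measure Ω} [IsFiniteMeasure μ] (hm : m' ≤ m) {f g : Ω → ℝ} {C ε : ℝ}
    (hf : StronglyMeasurable[m'] f) (hf0 : ∀ ω, 0 ≤ f ω) (hfC : ∀ ω, f ω ≤ C)
    (hg : Integrable g μ) (hfg : ∀ᵐ ω ∂μ, f ω ≠ 0 → ε ≤ (μ[g | m']) ω) :
    ε * ∫ ω, f ω ∂μ ≤ ∫ ω, f ω * g ω ∂μ := by
  have hbdd : ∀ᵐ ω ∂μ, ‖f ω‖ ≤ C :=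
    ae_of_all _ fun ω => by rw [Real.norm_of_nonneg (hf0 ω)]; exact hfC ω
  have hfm : AEStronglyMeasurable f μ := (hf.mono hm).aestronglyMeasurable
  have hprod : Integrable (f * g) μ := hg.bdd_mul hfm hbdd
  have hpull : μ[f * g | m'] =ᵐ[μ] f * μ[g | m'] :=
    condExp_mul_of_stronglyMeasurable_left hf hprod hg
  calc ε * ∫ ω, f ω ∂μ = ∫ ω, ε * f ω ∂μ := (integral_const_mul _ _).symm
    _ ≤ ∫ ω, (μ[f * g | m']) ω ∂μ := by
        refine integral_mono_ae ((Integrable.of_bound hfm C hbdd).const_mul ε)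
          integrable_condExp ?_
        filter_upwards [hpull, hfg] with ω h₁ h₂
        rw [h₁, Pi.mul_apply]
        by_cases h : f ω = 0
        · simp [h]
        · rw [mul_comm]
          exact mul_le_mul_of_nonneg_left (h₂ h) (hf0 ω)
    _ = ∫ ω, f ω * g ω ∂μ := integral_condExp hm

/-- A bounded real sequence cannot grow by at least a fixed positive amount at each step. -/
theorem nonpos_of_add_le_succ_of_le {a : ℕ → ℝ} {p C : ℝ} (hstep : ∀ n, a n + p ≤ a (n + 1))
    (hC : ∀ n, a n ≤ C) : p ≤ 0 := by
  have hlin : ∀ n : ℕ, a 0 + n * p ≤ a n := by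
    intro n
    induction n with
    | zero => simp
    | succ n ih => push_cast; linarith [hstep n]
  by_contra! hp
  obtain ⟨n, hn⟩ := exists_nat_gt ((C - a 0) / p)
  rw [div_lt_iff₀ hp] at hn
  linarith [hlin n, hC n]

/-- Exponential potential of a bounded variant: `B ^ (High - Y n)`, with the exponent truncated to
`[0, K]`, before `τ`, and its maximal value `B ^ K` from `τ` on. -/
noncomputable def variantPotential {Ω : Type*} (Y : ℕ → Ω → ℤ) (τ : Ω → ℕ∞) (High : ℤ) (K : ℕ)
    (B : ℝ) (n : ℕ) (ω : Ω) : ℝ :=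
  if τ ω ≤ (n : ℕ∞) then B ^ K else B ^ min (High - Y n ω).toNat K

section variantPotential

variable {Ω : Type*} {Y : ℕ → Ω → ℤ} {τ : Ω → ℕ∞} {High : ℤ} {K : ℕ} {B : ℝ}

theorem one_le_variantPotential (hB : 1 ≤ B) (n : ℕ) (ω : Ω) :
    1 ≤ variantPotential Y τ High K B n ω := by
  unfold variantPotential
  split_ifs <;> exact one_le_pow₀ hB

theorem variantPotential_le (hB : 1 ≤ B) (n : ℕ) (ω : Ω) :
    variantPotential Y τ High K B n ω ≤ B ^ K := by
  unfold variantPotential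
  split_ifs
  · exact le_rfl
  · exact pow_le_pow_right₀ hB (min_le_right _ _)

theorem variantPotential_succ_of_le {n : ℕ} {ω : Ω} (h : τ ω ≤ (n : ℕ∞)) :
    variantPotential Y τ High K B (n + 1) ω = variantPotential Y τ High K B n ω := by
  have h' : τ ω ≤ ((n + 1 : ℕ) : ℕ∞) := h.trans (by exact_mod_cast n.le_succ)
  simp only [variantPotential, if_pos h, if_pos h']

theorem mul_variantPotential_le_succ {n : ℕ} {ω : Ω} (hB : 1 ≤ B) (h : (n : ℕ∞) < τ ω)
    (hlow : High - K < Y n ω) (hhigh : Y n ω ≤ High) (hdec : Y (n + 1) ω < Y n ω) :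
    variantPotential Y τ High K B n ω * B ≤ variantPotential Y τ High K B (n + 1) ω := by
  simp only [variantPotential, if_neg h.not_ge, ← pow_succ]
  split_ifs <;> exact pow_le_pow_right₀ hB (by omega)

theorem measurable_variantPotential {m : MeasurableSpace Ω} {n : ℕ} (hY : Measurable (Y n))
    (hτ : MeasurableSet {ω | τ ω ≤ (n : ℕ∞)}) :
    Measurable (variantPotential Y τ High K B n) :=
  Measurable.ite hτ measurable_const
    ((measurable_from_top (f := fun y : ℤ => B ^ min (High - y).toNat K)).comp hY)

end variantPotential

/-- Bounded integer variant rule (Theorem 3.3, stochastic-process form). -/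
theorem stmt_1 {Ω : Type*} {m : MeasurableSpace Ω} {μ : Measure Ω} [IsProbabilityMeasure μ]
    (ℱ : Filtration ℕ m) (Y : ℕ → Ω → ℤ)
    (hadp : Adapted ℱ Y)
    (τ : Ω → ℕ∞)
    (hτ : ∀ n : ℕ, MeasurableSet[ℱ n] {ω | τ ω ≤ (n : ℕ∞)})
    (Low High : ℤ) (hLH : Low ≤ High)
    (ε : ℝ) (hε0 : 0 < ε) (hε1 : ε ≤ 1)
    (hbound : ∀ n : ℕ, ∀ᵐ ω ∂μ, (n : ℕ∞) < τ ω → Low < Y n ω ∧ Y n ω ≤ High)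
    (hprog : ∀ n : ℕ, ∀ᵐ ω ∂μ, (n : ℕ∞) < τ ω →
      ε ≤ (μ[Set.indicator {ω' | Y (n + 1) ω' < Y n ω'} (fun _ => (1 : ℝ)) | ℱ n]) ω) :
    μ {ω | τ ω < ⊤} = 1 := by
  obtain ⟨K, hK⟩ : ∃ K : ℕ, (K : ℤ) = High - Low := ⟨(High - Low).toNat, by omega⟩
  set B : ℝ := 2 / ε with hBdef
  have hεB : ε * B = 2 := by rw [hBdef]; field_simp
  have hB : 1 ≤ B := by rw [hBdef, le_div_iff₀ hε0]; linarith
  set Z : ℕ → Ω → ℝ := variantPotential Y τ High K B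
  have hZ1 : ∀ n ω, 1 ≤ Z n ω := one_le_variantPotential hB
  have hZK : ∀ n ω, Z n ω ≤ B ^ K := variantPotential_le hB
  have hZm : ∀ n, Measurable[ℱ n] (Z n) := fun n => measurable_variantPotential (hadp n) (hτ n)
  have hZint : ∀ n, Integrable (Z n) μ := fun n =>
    Integrable.of_bound ((hZm n).mono (ℱ.le n) le_rfl).aestronglyMeasurable (B ^ K)
      (ae_of_all _ fun ω => by
        rw [Real.norm_of_nonneg (zero_le_one.trans (hZ1 n ω))]; exact hZK n ω)
  have hS : ∀ n : ℕ, MeasurableSet[ℱ n] {ω | (n : ℕ∞) < τ ω} := fun n => by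
    simpa only [Set.compl_ofPred, not_le] using (hτ n).compl
  have hfin : MeasurableSet {ω | τ ω < ⊤} := by
    have : {ω | τ ω < ⊤} = ⋃ n : ℕ, {ω | τ ω ≤ (n : ℕ∞)} := by
      ext ω
      simp only [Set.mem_ofPred_eq, Set.mem_iUnion]
      refine ⟨fun h => ⟨(τ ω).toNat, (ENat.natCast_toNat h.ne).ge⟩, ?_⟩
      rintro ⟨n, hn⟩
      exact hn.trans_lt (ENat.natCast_lt_top n)
    rw [this]
    exact MeasurableSet.iUnion fun n => ℱ.le n _ (hτ n)
  have hstep : ∀ n, ∫ ω, Z n ω ∂μ + μ.real {ω | τ ω < ⊤}ᶜ ≤ ∫ ω, Z (n + 1) ω ∂μ := by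
    intro n
    set S : Set Ω := {ω | (n : ℕ∞) < τ ω} with hSdef
    set A : Set Ω := {ω | Y (n + 1) ω < Y n ω} with hAdef
    have hSm : MeasurableSet S := ℱ.le n _ (hS n)
    have hA : MeasurableSet A :=
      measurableSet_lt ((hadp (n + 1)).mono (ℱ.le _) le_rfl) ((hadp n).mono (ℱ.le _) le_rfl)
    have hgint : Integrable (A.indicator fun _ => (1 : ℝ)) μ := (integrable_const 1).indicator hA
    have hSZ : Integrable (S.indicator (Z n)) μ := (hZint n).indicator hSm
    have hSZ0 : ∀ ω, 0 ≤ S.indicator (Z n) ω :=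
      Set.indicator_nonneg fun ω _ => zero_le_one.trans (hZ1 n ω)
    have hSZK : ∀ ω, S.indicator (Z n) ω ≤ B ^ K := fun ω =>
      (Set.indicator_le_self' (fun _ _ => zero_le_one.trans (hZ1 n _)) ω).trans (hZK n ω)
    have hSZA : Integrable (fun ω => S.indicator (Z n) ω * A.indicator (fun _ => (1 : ℝ)) ω) μ :=
      hgint.bdd_mul hSZ.aestronglyMeasurable
        (ae_of_all _ fun ω => by rw [Real.norm_of_nonneg (hSZ0 ω)]; exact hSZK ω)
    have hgain : ε * ∫ ω, S.indicator (Z n) ω ∂μ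
        ≤ ∫ ω, S.indicator (Z n) ω * A.indicator (fun _ => (1 : ℝ)) ω ∂μ := by
      refine mul_integral_le_integral_mul_of_le_condExp (ℱ.le n)
        ((hZm n).indicator (hS n)).stronglyMeasurable hSZ0 hSZK hgint ?_
      filter_upwards [hprog n] with ω h hne
      have hω : ω ∈ S := Set.mem_of_indicator_ne_zero hne
      exact h hω
    have hmass : μ.real {ω | τ ω < ⊤}ᶜ ≤ ∫ ω, S.indicator (Z n) ω ∂μ := by
      rw [← integral_indicator_one hfin.compl]
      refine integral_mono ((integrable_const 1).indicator hfin.compl) hSZ fun ω => ?_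
      by_cases h : τ ω < ⊤
      · simpa [h] using hSZ0 ω
      · have htop : τ ω = ⊤ := not_lt_top_iff.mp h
        have : ω ∈ S := by simp [hSdef, htop]
        simpa [htop, this] using hZ1 n ω
    have hpointwise : ∫ ω, (Z n ω - S.indicator (Z n) ω
        + B * (S.indicator (Z n) ω * A.indicator (fun _ => (1 : ℝ)) ω)) ∂μ
        ≤ ∫ ω, Z (n + 1) ω ∂μ := by
      refine integral_mono_ae (((hZint n).sub hSZ).add (hSZA.const_mul B)) (hZint (n + 1)) ?_
      filter_upwards [hbound n] with ω h
      by_cases hω : ω ∈ S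
      · by_cases hωA : ω ∈ A
        · obtain ⟨hlow, hhigh⟩ := h hω
          have := mul_variantPotential_le_succ (K := K) hB hω (by omega) hhigh hωA
          simpa [hω, hωA, mul_comm B] using this
        · simpa [hω, hωA] using zero_le_one.trans (hZ1 (n + 1) ω)
      · simpa [hω] using (variantPotential_succ_of_le (not_lt.mp hω)).ge
    rw [integral_add (by exact (hZint n).sub hSZ) (hSZA.const_mul B),
      integral_sub (hZint n) hSZ, integral_const_mul] at hpointwise
    have hgainB := mul_le_mul_of_nonneg_left hgain (zero_le_one.trans hB)
    rw [← mul_assoc, mul_comm B, hεB] at hgainB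
    linarith
  have hzero : μ.real {ω | τ ω < ⊤}ᶜ ≤ 0 :=
    nonpos_of_add_le_succ_of_le hstep (C := B ^ K) fun n => by
      simpa using integral_mono (hZint n) (integrable_const (μ := μ) (B ^ K)) (hZK n)
  rw [← prob_compl_eq_zero_iff hfin]
  exact (measureReal_eq_zero_iff).mp (le_antisymm hzero measureReal_nonneg)
end

section
/- Non-termination certificate (Corollary 5.2, Markov-chain form): Let S be a countable set with the discrete σ-algebra, K : S → PMF(S) a transition function, and s₀ ∈ S absorbing, i.e. K(s₀) is the point mass at s₀. If there exists a bounded, non-constant function V : S → ℝ that is harmonic at every s ≠ s₀ (i.e. ∑_{t∈S} K(s)(t)·V(t) = V(s), the sum converging absolutely since V is bounded), then there exists a state s ∈ S such that every Markov chain X with kernel K started at s satisfies ℙ(∃ n, X_n = s₀) < 1; that is, from some initial state the chain does not reach s₀ almost surely. -/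
open MeasureTheory Filter

/-- A Markov chain with kernel `K` started at `s`: an adapted process with
`X 0 = s` a.s. and one-step transition probabilities given by `K`. -/
def IsMarkovChain {S : Type} [MeasurableSpace S]
    {Ω : Type} {m : MeasurableSpace Ω} (μ : Measure Ω) (ℱ : Filtration ℕ m)
    (K : S → PMF S) (s : S) (X : ℕ → Ω → S) : Prop :=
  (∀ n, Measurable[ℱ n] (X n)) ∧ (∀ᵐ ω ∂μ, X 0 ω = s) ∧
    ∀ (n : ℕ) (t : S), ∀ᵐ ω ∂μ,
      (μ[Set.indicator {ω' | X (n + 1) ω' = t} (fun _ => (1 : ℝ)) | ℱ n]) ω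
        = ((K (X n ω)) t).toReal

namespace IsMarkovChain

variable {S : Type} [MeasurableSpace S] {Ω : Type} {m : MeasurableSpace Ω} {μ : Measure Ω}
  {ℱ : Filtration ℕ m} {K : S → PMF S} {s : S} {X : ℕ → Ω → S}

theorem measurable (h : IsMarkovChain μ ℱ K s X) (n : ℕ) : Measurable (X n) :=
  (h.1 n).mono (ℱ.le n) le_rfl

/-- The joint probability of an event of the past and of the next state. -/
theorem measureReal_inter_eq [DiscreteMeasurableSpace S] [IsProbabilityMeasure μ]
    (h : IsMarkovChain μ ℱ K s X) (n : ℕ) (t : S) {A : Set Ω} (hA : MeasurableSet[ℱ n] A) :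
    μ.real (A ∩ {ω | X (n + 1) ω = t}) = ∫ ω in A, ((K (X n ω)) t).toReal ∂μ := by
  have hB : MeasurableSet {ω | X (n + 1) ω = t} :=
    h.measurable (n + 1) (MeasurableSet.of_discrete (s := {t}))
  have hint : Integrable (Set.indicator {ω | X (n + 1) ω = t} (fun _ => (1 : ℝ))) μ :=
    (integrable_const 1).indicator hB
  rw [← setIntegral_congr_ae (ℱ.le n _ hA) ((h.2.2 n t).mono fun ω hω _ => hω),
    setIntegral_condExp (ℱ.le n) hint hA, integral_indicator hB]
  simp [Measure.real, Measure.restrict_apply hB, Set.inter_comm]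

/-- The expectation of a bounded harmonic function is constant along the chain. -/
theorem integral_succ_eq [Countable S] [DiscreteMeasurableSpace S] [IsProbabilityMeasure μ]
    (h : IsMarkovChain μ ℱ K s X) {V : S → ℝ} {C : ℝ} (hC : ∀ s, |V s| ≤ C)
    (hV : ∀ s, ∑' t, ((K s) t).toReal * V t = V s) (n : ℕ) :
    ∫ ω, V (X (n + 1) ω) ∂μ = ∫ ω, V (X n ω) ∂μ := by
  have hprob (t : S) : (μ.map (X (n + 1))).real {t} = ∫ ω, ((K (X n ω)) t).toReal ∂μ := by
    rw [map_measureReal_apply (h.measurable _) (MeasurableSet.singleton t)]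
    simpa using! h.measureReal_inter_eq n t MeasurableSet.univ
  have : IsProbabilityMeasure (μ.map (X (n + 1))) :=
    Measure.isProbabilityMeasure_map (h.measurable _).aemeasurable
  have hVint : Integrable V (μ.map (X (n + 1))) :=
    .of_bound Measurable.of_discrete.aestronglyMeasurable C (.of_forall hC)
  have hmeas (f : S → ℝ) : Measurable fun ω => f (X n ω) :=
    (Measurable.of_discrete (f := f)).comp (h.measurable n)
  have hKint (t : S) : Integrable (fun ω => ((K (X n ω)) t).toReal * V t) μ := by
    refine Integrable.mul_const (.of_bound (hmeas fun x => (K x t).toReal).aestronglyMeasurable 1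
      (.of_forall fun ω => ?_)) _
    simpa using ENNReal.toReal_mono ENNReal.one_ne_top ((K (X n ω)).coe_le_one t)
  have hsum : Summable fun t => ∫ ω, ‖((K (X n ω)) t).toReal * V t‖ ∂μ := by
    have hnorm := hVint.norm
    rw [← Measure.sum_smul_dirac (μ.map (X (n + 1)))] at hnorm
    simp_rw [norm_mul, integral_mul_const, Real.norm_of_nonneg ENNReal.toReal_nonneg, ← hprob]
    simpa [integral_smul_measure, Measure.real] using (hasSum_integral_measure hnorm).summable
  calc ∫ ω, V (X (n + 1) ω) ∂μ = ∫ x, V x ∂μ.map (X (n + 1)) :=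
        (integral_map (h.measurable _).aemeasurable
          Measurable.of_discrete.aestronglyMeasurable).symm
    _ = ∑' t, ∫ ω, ((K (X n ω)) t).toReal * V t ∂μ := by
        simp_rw [integral_countable hVint, hprob, integral_mul_const, smul_eq_mul]
    _ = ∫ ω, V (X n ω) ∂μ := by
        simp_rw [integral_tsum_of_summable_integral_norm hKint hsum, hV]

/-- Once in an absorbing state, the chain almost surely stays there. -/
theorem ae_absorbed [DiscreteMeasurableSpace S] [IsProbabilityMeasure μ]
    (h : IsMarkovChain μ ℱ K s X) {s₀ : S} (habs : K s₀ = PMF.pure s₀) :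
    ∀ᵐ ω ∂μ, ∀ n, X n ω = s₀ → X (n + 1) ω = s₀ := by
  refine ae_all_iff.2 fun n => ?_
  have hA : MeasurableSet[ℱ n] {ω | X n ω = s₀} := h.1 n (MeasurableSet.of_discrete (s := {s₀}))
  have hB : MeasurableSet {ω | X (n + 1) ω = s₀} :=
    h.measurable (n + 1) (MeasurableSet.of_discrete (s := {s₀}))
  have hreal := h.measureReal_inter_eq n s₀ hA
  rw [setIntegral_congr_fun (g := fun _ => (1 : ℝ)) (ℱ.le n _ hA)
    (fun ω (hω : X n ω = s₀) => by simp [hω, habs])] at hreal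
  have hdiff := measureReal_inter_add_sdiff (μ := μ) (s := {ω | X n ω = s₀}) hB
  have hzero : μ.real ({ω | X n ω = s₀} \ {ω | X (n + 1) ω = s₀}) = 0 := by
    simp at hreal
    linarith
  rw [measureReal_eq_zero_iff] at hzero
  refine measure_mono_null (fun ω hω => ?_) hzero
  simpa using hω

end IsMarkovChain

/-- Non-termination certificate (Corollary 5.2, Markov-chain form). -/
theorem stmt_3 {S : Type} [Countable S] [MeasurableSpace S] [DiscreteMeasurableSpace S]
    (K : S → PMF S) (s₀ : S) (habs : K s₀ = PMF.pure s₀)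
    (V : S → ℝ)
    (hVbdd : ∃ C : ℝ, ∀ s, |V s| ≤ C)
    (hVnonconst : ∃ s t : S, V s ≠ V t)
    (hVharm : ∀ s : S, s ≠ s₀ → ∑' t : S, ((K s) t).toReal * V t = V s) :
    ∃ s : S, ∀ (Ω : Type) (m : MeasurableSpace Ω) (μ : Measure Ω),
      IsProbabilityMeasure μ → ∀ (ℱ : Filtration ℕ m) (X : ℕ → Ω → S),
        IsMarkovChain μ ℱ K s X → μ {ω | ∃ n, X n ω = s₀} < 1 := by
  obtain ⟨C, hC⟩ := hVbdd
  obtain ⟨s, hs⟩ : ∃ s, V s ≠ V s₀ := by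
    by_contra! hconst
    obtain ⟨a, b, hab⟩ := hVnonconst
    exact hab ((hconst a).trans (hconst b).symm)
  have hV (x : S) : ∑' t, ((K x) t).toReal * V t = V x := by
    rcases eq_or_ne x s₀ with rfl | hx
    · rw [tsum_eq_single x fun t ht => by simp [habs, ht]]
      simp [habs]
    · exact hVharm x hx
  refine ⟨s, fun Ω m μ hμ ℱ X h => lt_of_le_of_ne prob_le_one fun hone => hs ?_⟩
  have hhit : ∀ᵐ ω ∂μ, ∃ n, X n ω = s₀ := by
    refine (prob_compl_eq_zero_iff ?_).2 hone
    simp only [Set.ofPred_exists]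
    exact .iUnion fun n => h.measurable n (MeasurableSet.of_discrete (s := {s₀}))
  have hmean (n : ℕ) : ∫ ω, V (X n ω) ∂μ = V s := by
    induction n with
    | zero =>
      rw [integral_congr_ae (h.2.1.mono fun ω hω => congrArg V hω)]
      simp
    | succ n ih => rw [h.integral_succ_eq hC hV, ih]
  have hlim : ∀ᵐ ω ∂μ, Tendsto (fun n => V (X n ω)) atTop (nhds (V s₀)) := by
    filter_upwards [hhit, h.ae_absorbed habs] with ω ⟨N, hN⟩ hstay
    have hfin (n : ℕ) (hn : N ≤ n) : X n ω = s₀ := by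
      induction n, hn using Nat.le_induction with
      | base => exact hN
      | succ n _ ih => exact hstay n ih
    exact tendsto_const_nhds.congr'
      ((eventually_ge_atTop N).mono fun n hn => (congrArg V (hfin n hn)).symm)
  have htend := tendsto_integral_of_dominated_convergence (μ := μ) (fun _ => C)
    (fun n => ((Measurable.of_discrete (f := V)).comp (h.measurable n)).aestronglyMeasurable)
    (integrable_const C) (fun n => .of_forall fun ω => hC _) hlim
  simp only [Function.comp_apply, hmean, integral_const, probReal_univ, one_smul] at htend
  exact tendsto_nhds_unique tendsto_const_nhds htend
end

section
/- Existence of a quasi-variant for the two-dimensional symmetric random walk (Corollary 5.3): There exist a function V : ℤ × ℤ → ℝ with V(z) ≥ 0 for all z, and an antitone function d : (0,∞) → ℝ with d(r) > 0 for all r > 0, such that: (i) V(z) = 0 if and only if z = (0,0); (ii) for every z ≠ (0,0), (1/4)·(V(z + e₁) + V(z − e₁) + V(z + e₂) + V(z − e₂)) ≤ V(z) (V is a super-martingale for the walk); and (iii) for every z ≠ (0,0), at least one of the four neighbours w ∈ {z + e₁, z − e₁, z + e₂, z − e₂} satisfies V(w) ≤ V(z) − d(V(z)) (so the progress condition holds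 with the constant probability function p ≡ 1/4). -/
/-- The exponential of the quasi-variant: an integer weight that is `1` at the origin and
`325 (4 |z|² - 3)` elsewhere. -/
def walkWeight (z : ℤ × ℤ) : ℤ :=
  if z = (0, 0) then 1 else 325 * (4 * (z.1 ^ 2 + z.2 ^ 2) - 3)

lemma walkWeight_zero : walkWeight (0, 0) = 1 := if_pos rfl

lemma walkWeight_of_ne {z : ℤ × ℤ} (hz : z ≠ (0, 0)) :
    walkWeight z = 325 * (4 * (z.1 ^ 2 + z.2 ^ 2) - 3) := if_neg hz

lemma one_le_sq_add_sq {z : ℤ × ℤ} (hz : z ≠ (0, 0)) : 1 ≤ z.1 ^ 2 + z.2 ^ 2 := by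
  by_contra! h
  have h₁ : z.1 = 0 := by nlinarith [sq_nonneg z.1, sq_nonneg z.2]
  have h₂ : z.2 = 0 := by nlinarith [sq_nonneg z.1, sq_nonneg z.2]
  exact hz (Prod.ext h₁ h₂)

lemma one_lt_walkWeight {z : ℤ × ℤ} (hz : z ≠ (0, 0)) : 1 < walkWeight z := by
  rw [walkWeight_of_ne hz]
  linarith [one_le_sq_add_sq hz]

lemma walkWeight_pos (z : ℤ × ℤ) : 0 < walkWeight z := by
  by_cases hz : z = (0, 0)
  · simp [hz, walkWeight_zero]
  · linarith [one_lt_walkWeight hz]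

/-- The points at distance one from the origin. -/
lemma sq_add_sq_eq_one_cases {x y : ℤ} (h : x ^ 2 + y ^ 2 = 1) :
    (x = 1 ∧ y = 0) ∨ (x = -1 ∧ y = 0) ∨ (x = 0 ∧ y = 1) ∨ (x = 0 ∧ y = -1) := by
  have hx₁ : x ≤ 1 := by nlinarith [sq_nonneg y]
  have hx₂ : -1 ≤ x := by nlinarith [sq_nonneg y]
  have hy₁ : y ≤ 1 := by nlinarith [sq_nonneg x]
  have hy₂ : -1 ≤ y := by nlinarith [sq_nonneg x]
  interval_cases x <;> interval_cases y <;> simp_all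

/-- Multiplicative form of the super-martingale inequality. -/
lemma walkWeight_mul_le_pow {z : ℤ × ℤ} (hz : z ≠ (0, 0)) :
    walkWeight (z + (1, 0)) * walkWeight (z - (1, 0)) * walkWeight (z + (0, 1)) *
      walkWeight (z - (0, 1)) ≤ walkWeight z ^ 4 := by
  obtain ⟨x, y⟩ := z
  rcases (one_le_sq_add_sq hz).eq_or_lt with h | h
  · rcases sq_add_sq_eq_one_cases h.symm with ⟨rfl, rfl⟩ | ⟨rfl, rfl⟩ | ⟨rfl, rfl⟩ | ⟨rfl, rfl⟩ <;>
      norm_num [walkWeight] <;> split_ifs <;> norm_num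
  · have key : ∀ a b : ℤ, a ^ 2 + b ^ 2 = 1 → (x + a, y + b) ≠ ((0 : ℤ), (0 : ℤ)) := by
      intro a b hab hne
      obtain ⟨h₁, h₂⟩ := Prod.ext_iff.1 hne
      simp only at h h₁ h₂
      have hx : x = -a := by linarith
      have hy : y = -b := by linarith
      subst hx hy
      linarith [neg_sq a, neg_sq b]
    rw [walkWeight_of_ne hz,
      walkWeight_of_ne (z := (x, y) + (1, 0)) (key 1 0 (by norm_num)),
      walkWeight_of_ne (z := (x, y) - (1, 0)) (key (-1) 0 (by norm_num)),
      walkWeight_of_ne (z := (x, y) + (0, 1)) (key 0 1 (by norm_num)),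
      walkWeight_of_ne (z := (x, y) - (0, 1)) (key 0 (-1) (by norm_num))]
    simp only [Prod.mk_add_mk, Prod.mk_sub_mk, add_zero, sub_zero] at h ⊢
    have hm : 4 ≤ (4 * (x ^ 2 + y ^ 2) - 3) ^ 2 := by nlinarith
    linear_combination (325 ^ 4 * 16) * hm + (325 ^ 4 * 1024) * sq_nonneg (x ^ 2 - y ^ 2)

lemma walkWeight_lt_of_sq_add_sq_lt {w z : ℤ × ℤ} (h : w.1 ^ 2 + w.2 ^ 2 < z.1 ^ 2 + z.2 ^ 2) :
    walkWeight w < walkWeight z := by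
  have hz : z ≠ (0, 0) := by
    rintro rfl
    simp only at h
    nlinarith [sq_nonneg w.1, sq_nonneg w.2]
  by_cases hw : w = (0, 0)
  · rw [hw, walkWeight_zero]
    exact one_lt_walkWeight hz
  · rw [walkWeight_of_ne hw, walkWeight_of_ne hz]
    linarith

/-- Away from the origin, some neighbour has strictly smaller weight. -/
lemma exists_neighbour_walkWeight_lt {z : ℤ × ℤ} (hz : z ≠ (0, 0)) :
    walkWeight (z + (1, 0)) < walkWeight z ∨ walkWeight (z - (1, 0)) < walkWeight z ∨
      walkWeight (z + (0, 1)) < walkWeight z ∨ walkWeight (z - (0, 1)) < walkWeight z := by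
  obtain ⟨x, y⟩ := z
  have hxy : x < 0 ∨ 0 < x ∨ y < 0 ∨ 0 < y := by
    by_contra! h
    exact hz (Prod.ext (by simp only; linarith) (by simp only; linarith))
  refine hxy.imp ?_ (Or.imp ?_ (Or.imp ?_ ?_)) <;> intro h <;>
    apply walkWeight_lt_of_sq_add_sq_lt <;>
    simp only [Prod.mk_add_mk, Prod.mk_sub_mk, add_zero, sub_zero] <;> nlinarith

/-- A strict decrease of a positive integer `b` lowers its logarithm by at least `1 / b`. -/
lemma log_intCast_le_sub_exp_neg_log {a b : ℤ} (ha : 0 < a) (hab : a < b) :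
    Real.log a ≤ Real.log b - Real.exp (-Real.log b) := by
  have ha' : (0 : ℝ) < a := by exact_mod_cast ha
  have hb' : (0 : ℝ) < b := by exact_mod_cast ha.trans hab
  have hab' : (a : ℝ) + 1 ≤ b := by exact_mod_cast hab
  have h₁ := Real.log_le_sub_one_of_pos (div_pos ha' hb')
  rw [Real.log_div ha'.ne' hb'.ne'] at h₁
  have h₂ : (a : ℝ) / b - 1 ≤ -(b : ℝ)⁻¹ := by
    have : (a : ℝ) / b - 1 + (b : ℝ)⁻¹ = (a + 1 - b) / b := by field_simp; ring
    have := div_nonpos_of_nonpos_of_nonneg (sub_nonpos.2 hab') hb'.le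
    linarith
  rw [Real.exp_neg, Real.exp_log hb']
  linarith

/-- Existence of a quasi-variant for the two-dimensional symmetric random walk
(Corollary 5.3). -/
theorem stmt_5 :
    ∃ (V : ℤ × ℤ → ℝ) (d : ℝ → ℝ),
      (∀ z, 0 ≤ V z) ∧
      (∀ x y : ℝ, 0 < x → x ≤ y → d y ≤ d x) ∧
      (∀ r : ℝ, 0 < r → 0 < d r) ∧
      (∀ z, V z = 0 ↔ z = (0, 0)) ∧
      (∀ z : ℤ × ℤ, z ≠ (0, 0) →
        (1 / 4 : ℝ) * (V (z + (1, 0)) + V (z - (1, 0)) + V (z + (0, 1)) + V (z - (0, 1)))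
          ≤ V z) ∧
      (∀ z : ℤ × ℤ, z ≠ (0, 0) →
        V (z + (1, 0)) ≤ V z - d (V z) ∨ V (z - (1, 0)) ≤ V z - d (V z) ∨
        V (z + (0, 1)) ≤ V z - d (V z) ∨ V (z - (0, 1)) ≤ V z - d (V z)) := by
  have hpos (z : ℤ × ℤ) : (0 : ℝ) < walkWeight z := by exact_mod_cast walkWeight_pos z
  refine ⟨fun z => Real.log (walkWeight z), fun r => Real.exp (-r), ?_, ?_, ?_, ?_, ?_, ?_⟩
  · intro z
    exact Real.log_nonneg (by exact_mod_cast walkWeight_pos z)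
  · intro x y _ hxy
    exact Real.exp_le_exp.2 (neg_le_neg hxy)
  · intro r _
    exact Real.exp_pos _
  · intro z
    constructor
    · intro h
      by_contra hz
      exact (Real.log_pos (by exact_mod_cast one_lt_walkWeight hz)).ne' h
    · rintro rfl
      simp [walkWeight_zero]
  · intro z hz
    have h := Real.log_le_log
      (mul_pos (mul_pos (mul_pos (hpos (z + (1, 0))) (hpos (z - (1, 0)))) (hpos (z + (0, 1))))
        (hpos (z - (0, 1))))
      (by exact_mod_cast walkWeight_mul_le_pow hz :
        (_ : ℝ) ≤ (walkWeight z : ℝ) ^ 4)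
    rw [Real.log_mul (by simp [(hpos _).ne']) (hpos _).ne',
      Real.log_mul (by simp [(hpos _).ne']) (hpos _).ne',
      Real.log_mul (hpos _).ne' (hpos _).ne', Real.log_pow] at h
    push_cast at h
    linarith
  · intro z hz
    have step (w : ℤ × ℤ) (h : walkWeight w < walkWeight z) :=
      log_intCast_le_sub_exp_neg_log (walkWeight_pos w) h
    exact (exists_neighbour_walkWeight_lt hz).imp (step _)
      (Or.imp (step _) (Or.imp (step _) (step _)))
end

section
/- Almost-sure termination of the negative binomial loop (Section 4.1): Let (X_n)_{n∈ℕ} be an adapted process of ℕ-valued random variables such that for every n, almost surely on the event {X_n > 0}: ℙ(X_{n+1} = X_n − 1 ∣ ℱ_n) = 1/2 and ℙ(X_{n+1} = X_n ∣ ℱ_n) = 1/2. Then almost surely there exists n with X_n = 0. -/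
open MeasureTheory Filter

/-- If two events are disjoint on a measurable set `C` of the conditioning σ-algebra and their
conditional probabilities sum to one there, then almost surely on `C` one of them happens. -/
theorem ae_mem_or_mem_of_condExp_add_eq_one {Ω : Type*} {m₀ m : MeasurableSpace Ω}
    {μ : Measure Ω} [IsFiniteMeasure μ] (hm : m₀ ≤ m) {A B C : Set Ω}
    (hA : MeasurableSet A) (hB : MeasurableSet B) (hC : MeasurableSet[m₀] C)
    (hdisj : ∀ ω ∈ C, ω ∈ A → ω ∉ B)
    (hsum : ∀ᵐ ω ∂μ, ω ∈ C → (μ[A.indicator (fun _ => (1 : ℝ)) | m₀]) ω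
      + (μ[B.indicator (fun _ => (1 : ℝ)) | m₀]) ω = 1) :
    ∀ᵐ ω ∂μ, ω ∈ C → ω ∈ A ∨ ω ∈ B := by
  have iA : Integrable (A.indicator (fun _ => (1 : ℝ))) μ := (integrable_const _).indicator hA
  have iB : Integrable (B.indicator (fun _ => (1 : ℝ))) μ := (integrable_const _).indicator hB
  have hint : ∫ ω in C, (1 - (A.indicator (fun _ => (1 : ℝ)) ω
      + B.indicator (fun _ => (1 : ℝ)) ω)) ∂μ = 0 := by
    rw [integral_sub (integrable_const _) (by exact (iA.add iB).integrableOn),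
      integral_add iA.integrableOn iB.integrableOn, ← setIntegral_condExp hm iA hC,
      ← setIntegral_condExp hm iB hC,
      ← integral_add integrable_condExp.integrableOn integrable_condExp.integrableOn,
      setIntegral_congr_ae (hm _ hC) hsum, sub_self]
  rw [setIntegral_eq_zero_iff_of_nonneg_ae] at hint
  · rw [EventuallyEq, ae_restrict_iff' (hm _ hC)] at hint
    filter_upwards [hint] with ω hω hωC
    by_contra! h
    simpa [h.1, h.2] using hω hωC
  · rw [EventuallyLE, ae_restrict_iff' (hm _ hC)]
    refine Eventually.of_forall fun ω hωC => ?_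
    by_cases hωA : ω ∈ A
    · simp [hωA, hdisj ω hωC hωA]
    · by_cases hωB : ω ∈ B <;> simp [hωA, hωB]
  · exact ((integrable_const _).sub (iA.add iB)).integrableOn

/-- An antitone sequence of natural numbers does not decrease infinitely often. -/
theorem Antitone.not_frequently_succ_lt {x : ℕ → ℕ} (hx : Antitone x) :
    ¬ ∃ᶠ n in atTop, x (n + 1) < x n := by
  intro h
  obtain ⟨k, hk, hlt⟩ := frequently_atTop.1 h (Function.argmin x)
  exact Function.not_lt_argmin x (k + 1) (hlt.trans_le (hx hk))

/-- Almost-sure termination of the negative binomial loop (Section 4.1). -/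
theorem stmt_8 {Ω : Type*} {m : MeasurableSpace Ω} {μ : Measure Ω} [IsProbabilityMeasure μ]
    (ℱ : Filtration ℕ m) (X : ℕ → Ω → ℕ)
    (hadp : Adapted ℱ X)
    (hstep : ∀ n : ℕ, ∀ᵐ ω ∂μ, 0 < X n ω →
      (μ[Set.indicator {ω' | X (n + 1) ω' = X n ω' - 1} (fun _ => (1 : ℝ)) | ℱ n]) ω
          = 1 / 2
        ∧ (μ[Set.indicator {ω' | X (n + 1) ω' = X n ω'} (fun _ => (1 : ℝ)) | ℱ n]) ω
          = 1 / 2) :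
    ∀ᵐ ω ∂μ, ∃ n, X n ω = 0 := by
  have hX (n : ℕ) : Measurable[ℱ (n + 1)] (X n) := (hadp n).mono (ℱ.mono n.le_succ) le_rfl
  have hA (n : ℕ) : MeasurableSet[ℱ (n + 1)] {ω | X (n + 1) ω = X n ω - 1} :=
    measurableSet_eq_fun (hadp (n + 1))
      ((measurable_of_countable fun k : ℕ => k - 1).comp (hX n))
  have hB (n : ℕ) : MeasurableSet[ℱ (n + 1)] {ω | X (n + 1) ω = X n ω} :=
    measurableSet_eq_fun (hadp (n + 1)) (hX n)
  have hor (n : ℕ) : ∀ᵐ ω ∂μ, 0 < X n ω → X (n + 1) ω = X n ω - 1 ∨ X (n + 1) ω = X n ω := by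
    refine ae_mem_or_mem_of_condExp_add_eq_one (C := {ω | 0 < X n ω})
      (A := {ω | X (n + 1) ω = X n ω - 1}) (B := {ω | X (n + 1) ω = X n ω}) (ℱ.le n)
      (ℱ.le _ _ (hA n)) (ℱ.le _ _ (hB n)) (hadp n (measurableSet_Ioi (a := 0))) ?_ ?_
    · intro ω hω h₁ h₂
      simp only [Set.mem_ofPred_eq] at hω h₁ h₂
      omega
    · filter_upwards [hstep n] with ω hω hpos
      rw [(hω hpos).1, (hω hpos).2]
      norm_num
  let s : ℕ → Set Ω := fun n => n.casesOn ∅ fun k => {ω | X (k + 1) ω = X k ω - 1}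
  have hs : ∀ n, MeasurableSet[ℱ n] (s n) := by
    rintro (_ | n)
    · exact @MeasurableSet.empty _ (ℱ 0)
    · exact hA n
  filter_upwards [ae_mem_limsup_atTop_iff μ hs, ae_all_iff.2 hstep, ae_all_iff.2 hor]
    with ω hlim hhalf hdec
  by_contra! h
  have hpos (n : ℕ) : 0 < X n ω := Nat.pos_of_ne_zero (h n)
  have hmem : ω ∈ limsup s atTop := by
    refine hlim.2 ?_
    have hsum (n : ℕ) : ∑ k ∈ Finset.range n, (μ[(s (k + 1)).indicator 1 | ℱ k]) ω
        = n * (1 / 2 : ℝ) := by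
      have hk (k : ℕ) : (μ[(s (k + 1)).indicator 1 | ℱ k]) ω = (1 / 2 : ℝ) :=
        (hhalf k (hpos k)).1
      simp [hk]
    simp only [hsum]
    exact tendsto_natCast_atTop_atTop.atTop_mul_const (by norm_num)
  rw [mem_limsup_iff_frequently_mem] at hmem
  have hanti : Antitone fun n => X n ω := antitone_nat_of_succ_le fun n => by
    have := hdec n (hpos n)
    omega
  refine hanti.not_frequently_succ_lt (frequently_atTop.2 fun a => ?_)
  obtain ⟨_ | k, hk, hω⟩ := frequently_atTop.1 hmem (a + 1)
  · omega
  · have hω : X (k + 1) ω = X k ω - 1 := hω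
    have := hpos k
    exact ⟨k, by omega, by omega⟩
end

section
/- Almost-sure termination of the demonically fair random walk (Section 4.2): Let (X_n)_{n∈ℕ} be an adapted process of ℤ-valued random variables such that for every n, almost surely on the event {X_n > 0}: ℙ(X_{n+1} = X_n − 1 ∣ ℱ_n) = 1/2 and X_{n+1} ∈ {X_n − 1, X_n, X_n + 1} almost surely (the remaining probability mass 1/2 is split arbitrarily, i.e. demonically and adaptively, between staying at X_n and moving to X_n + 1). Then almost surely there exists n with X_n ≤ 0. -/
open MeasureTheory Filter

open BorelCantelli in
/-- A bounded-above compensated counting process of adapted events converges almost surely. -/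
theorem ae_exists_tendsto_martingalePart_process {Ω : Type*} {m : MeasurableSpace Ω}
    {μ : Measure Ω} [IsFiniteMeasure μ] {ℱ : Filtration ℕ m} {s : ℕ → Set Ω}
    (hs : ∀ n, MeasurableSet[ℱ n] (s n)) :
    ∀ᵐ ω ∂μ, BddAbove (Set.range fun n => martingalePart (process s) ℱ μ n ω) →
      ∃ c, Tendsto (fun n => martingalePart (process s) ℱ μ n ω) atTop (nhds c) := by
  have hbdd := martingalePart_bdd_difference (μ := μ) (f := process s) (R := 1) ℱ
    (Eventually.of_forall (process_difference_le s))
  have hmart := martingale_martingalePart (μ := μ) (stronglyAdapted_process hs)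
    (integrable_process μ hs)
  filter_upwards [hmart.submartingale.bddAbove_iff_exists_tendsto (R := 2 * 1)
    (by simpa using hbdd)] with ω hω using hω.1

/-- Almost-sure termination of the demonically fair random walk (Section 4.2). -/
theorem stmt_9 {Ω : Type*} {m : MeasurableSpace Ω} {μ : Measure Ω} [IsProbabilityMeasure μ]
    (ℱ : Filtration ℕ m) (X : ℕ → Ω → ℤ)
    (hadp : Adapted ℱ X)
    (hdown : ∀ n : ℕ, ∀ᵐ ω ∂μ, 0 < X n ω →
      (μ[Set.indicator {ω' | X (n + 1) ω' = X n ω' - 1} (fun _ => (1 : ℝ)) | ℱ n]) ω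
        = 1 / 2)
    (hsupport : ∀ n : ℕ, ∀ᵐ ω ∂μ, 0 < X n ω →
      X (n + 1) ω = X n ω - 1 ∨ X (n + 1) ω = X n ω ∨ X (n + 1) ω = X n ω + 1) :
    ∀ᵐ ω ∂μ, ∃ n, X n ω ≤ 0 := by
  let s : ℕ → Set Ω := fun n => {ω | X n ω = X (n - 1) ω - 1}
  have hs : ∀ n, MeasurableSet[ℱ n] (s n) := fun n =>
    measurableSet_eq_fun (m := ℱ n) (hadp n)
      ((hadp.measurable_le (Nat.sub_le n 1)).sub_const 1)
  filter_upwards [ae_exists_tendsto_martingalePart_process (μ := μ) hs, ae_all_iff.2 hdown,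
    ae_all_iff.2 hsupport] with ω hconv hdown hsupport
  by_contra! hpos
  set M : ℕ → ℝ := fun n => martingalePart (BorelCantelli.process s) ℱ μ n ω with hM
  have hstep : ∀ n, (X (n + 1) ω = X n ω - 1 ∧ M (n + 1) = M n + 1 / 2) ∨
      (X (n + 1) ω ≤ X n ω + 1 ∧ M (n + 1) = M n - 1 / 2) := by
    intro n
    have hsucc : M (n + 1) = M n + ((s (n + 1)).indicator 1 ω - 1 / 2) := by
      simp only [hM, BorelCantelli.martingalePart_process_ae_eq, Finset.sum_range_succ,
        Pi.add_apply, Pi.sub_apply]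
      rw [← hdown n (hpos n)]
      rfl
    by_cases h : X (n + 1) ω = X n ω - 1
    · refine .inl ⟨h, ?_⟩
      rw [hsucc, Set.indicator_of_mem (show ω ∈ s (n + 1) from h), Pi.one_apply]
      ring
    · refine .inr ⟨by have := hsupport n (hpos n); omega, ?_⟩
      rw [hsucc, Set.indicator_of_notMem (show ω ∉ s (n + 1) from h)]
      ring
  have hle : ∀ n, (X n ω : ℝ) + 2 * M n ≤ X 0 ω + 2 * M 0 := by
    intro n
    induction n with
    | zero => rfl
    | succ n ih =>
      rcases hstep n with ⟨hX, hMn⟩ | ⟨hX, hMn⟩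
      · rw [hX, hMn]
        push_cast
        linarith
      · have : (X (n + 1) ω : ℝ) ≤ X n ω + 1 := by exact_mod_cast hX
        linarith
  obtain ⟨c, hc⟩ := hconv ⟨(X 0 ω + 2 * M 0) / 2, by
    rintro _ ⟨n, rfl⟩
    have hXn : (0 : ℝ) < X n ω := by exact_mod_cast hpos n
    change M n ≤ _
    linarith [hle n]⟩
  have hdiff : Tendsto (fun n => |M (n + 1) - M n|) atTop (nhds |c - c|) :=
    ((hc.comp (tendsto_add_atTop_nat 1)).sub hc).abs
  have habs : ∀ n, |M (n + 1) - M n| = 1 / 2 := by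
    intro n
    rcases hstep n with ⟨-, h⟩ | ⟨-, h⟩ <;> rw [h] <;> norm_num
  simp only [habs, sub_self, abs_zero] at hdiff
  exact absurd (tendsto_nhds_unique tendsto_const_nhds hdiff) (by norm_num)
end

section
/- Almost-sure termination of the escaping spline (Section 4.4): Let (X_n)_{n∈ℕ} be an adapted process of ℕ-valued random variables such that for every n, almost surely on the event {X_n > 0}: ℙ(X_{n+1} = 0 ∣ ℱ_n) = 1/(X_n + 1) and ℙ(X_{n+1} = X_n + 1 ∣ ℱ_n) = X_n/(X_n + 1). Then almost surely there exists n with X_n = 0. -/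
open MeasureTheory Filter

/-- If the conditional probability of `A` equals `1` almost surely on a set `B` of the conditioning
σ-algebra, then `B` is almost surely contained in `A`. -/
theorem ae_mem_of_condExp_indicator_eq_one {Ω : Type*} {m₀ m : MeasurableSpace Ω} {μ : Measure Ω}
    [IsFiniteMeasure μ] (hm : m₀ ≤ m) {A B : Set Ω} (hA : MeasurableSet A)
    (hB : MeasurableSet[m₀] B)
    (h : ∀ᵐ ω ∂μ, ω ∈ B → (μ[A.indicator (fun _ => (1 : ℝ)) | m₀]) ω = 1) :
    ∀ᵐ ω ∂μ, ω ∈ B → ω ∈ A := by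
  have hint : Integrable (A.indicator fun _ => (1 : ℝ)) μ := (integrable_const 1).indicator hA
  have hinter : μ.real (B ∩ A) = μ.real B := by
    calc μ.real (B ∩ A) = ∫ ω in B, A.indicator (fun _ => (1 : ℝ)) ω ∂μ := by
          simp [setIntegral_indicator hA]
      _ = ∫ ω in B, (μ[A.indicator (fun _ => (1 : ℝ)) | m₀]) ω ∂μ :=
          (setIntegral_condExp hm hint hB).symm
      _ = ∫ _ in B, (1 : ℝ) ∂μ := setIntegral_congr_ae (hm _ hB) h
      _ = μ.real B := by simp
  have hdiff : μ.real (B \ A) = 0 := by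
    linarith [measureReal_inter_add_sdiff (μ := μ) (s := B) hA]
  have hnull : μ (B \ A) = 0 := (measureReal_eq_zero_iff).1 hdiff
  filter_upwards [measure_eq_zero_iff_ae_notMem.1 hnull] with ω hω hωB
  by_contra hωA
  exact hω ⟨hωB, hωA⟩

/-- If the conditional probabilities of two disjoint events add up to `1` almost surely on a set `B`
of the conditioning σ-algebra, then almost surely on `B` one of the two events occurs. -/
theorem ae_mem_or_mem_of_condExp_indicator_add_eq_one {Ω : Type*} {m₀ m : MeasurableSpace Ω}
    {μ : Measure Ω} [IsFiniteMeasure μ] (hm : m₀ ≤ m) {A₁ A₂ B : Set Ω} (hA₁ : MeasurableSet A₁)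
    (hA₂ : MeasurableSet A₂) (hdisj : Disjoint A₁ A₂) (hB : MeasurableSet[m₀] B)
    (h : ∀ᵐ ω ∂μ, ω ∈ B → (μ[A₁.indicator (fun _ => (1 : ℝ)) | m₀]) ω
      + (μ[A₂.indicator (fun _ => (1 : ℝ)) | m₀]) ω = 1) :
    ∀ᵐ ω ∂μ, ω ∈ B → ω ∈ A₁ ∨ ω ∈ A₂ := by
  refine ae_mem_of_condExp_indicator_eq_one (A := A₁ ∪ A₂) hm (hA₁.union hA₂) hB ?_
  have hadd := condExp_add (μ := μ) ((integrable_const (1 : ℝ)).indicator hA₁)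
    ((integrable_const (1 : ℝ)).indicator hA₂) m₀
  have hunion : (A₁ ∪ A₂).indicator (fun _ => (1 : ℝ))
      = A₁.indicator (fun _ => (1 : ℝ)) + A₂.indicator (fun _ => (1 : ℝ)) :=
    Set.indicator_union_of_disjoint hdisj _
  rw [hunion]
  filter_upwards [hadd, h] with ω hω hsum hωB
  rw [hω, Pi.add_apply, hsum hωB]

/-- Every tail of the harmonic series diverges. -/
theorem tendsto_sum_range_one_div_add_atTop (a : ℕ) :
    Tendsto (fun n => ∑ k ∈ Finset.range n, 1 / (((a + k : ℕ) : ℝ) + 1)) atTop atTop := by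
  rw [← not_summable_iff_tendsto_nat_atTop_of_nonneg fun k => by positivity]
  intro hs
  refine Real.not_summable_one_div_natCast ((summable_nat_add_iff (a + 1)).1 (hs.congr fun k => ?_))
  push_cast
  ring_nf

/-- Almost-sure termination of the escaping spline (Section 4.4). -/
theorem stmt_12 {Ω : Type*} {m : MeasurableSpace Ω} {μ : Measure Ω} [IsProbabilityMeasure μ]
    (ℱ : Filtration ℕ m) (X : ℕ → Ω → ℕ)
    (hadp : Adapted ℱ X)
    (hstep : ∀ n : ℕ, ∀ᵐ ω ∂μ, 0 < X n ω →
      (μ[Set.indicator {ω' | X (n + 1) ω' = 0} (fun _ => (1 : ℝ)) | ℱ n]) ω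
          = 1 / ((X n ω : ℝ) + 1)
        ∧ (μ[Set.indicator {ω' | X (n + 1) ω' = X n ω' + 1} (fun _ => (1 : ℝ)) | ℱ n]) ω
          = (X n ω : ℝ) / ((X n ω : ℝ) + 1)) :
    ∀ᵐ ω ∂μ, ∃ n, X n ω = 0 := by
  have hmeas (n : ℕ) : Measurable (X n) := (hadp n).mono (ℱ.le n) le_rfl
  have hnext : ∀ᵐ ω ∂μ, ∀ n, 0 < X n ω → X (n + 1) ω = 0 ∨ X (n + 1) ω = X n ω + 1 := by
    refine ae_all_iff.2 fun n => ?_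
    refine ae_mem_or_mem_of_condExp_indicator_add_eq_one (ℱ.le n)
      (A₁ := {ω | X (n + 1) ω = 0}) (A₂ := {ω | X (n + 1) ω = X n ω + 1}) (B := {ω | 0 < X n ω})
      (hmeas (n + 1) (measurableSet_singleton 0))
      (measurableSet_eq_fun (hmeas (n + 1)) ((hmeas n).add_const 1)) ?_
      (hadp n measurableSet_Ioi) ?_
    · refine Set.disjoint_left.2 fun ω h₁ h₂ => ?_
      simp only [Set.mem_ofPred_eq] at h₁ h₂
      omega
    · filter_upwards [hstep n] with ω hω hpos
      obtain ⟨h₁, h₂⟩ := hω hpos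
      rw [h₁, h₂]
      field_simp
      ring
  have hlevy := ae_mem_limsup_atTop_iff (ℱ := ℱ) μ (s := fun n => {ω | X n ω = 0})
    fun n => hadp n (measurableSet_singleton 0)
  filter_upwards [hnext, hlevy, ae_all_iff.2 hstep] with ω hω hiff hcond
  by_contra! hne
  have hpos (n : ℕ) : 0 < X n ω := Nat.pos_of_ne_zero (hne n)
  have hX (n : ℕ) : X n ω = X 0 ω + n := by
    induction n with
    | zero => rfl
    | succ n ih =>
      rcases hω n (hpos n) with h | h
      · exact absurd h (hne _)
      · omega
  have hmem : ω ∈ limsup (fun n => {ω | X n ω = 0}) atTop := by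
    refine hiff.2 ((tendsto_sum_range_one_div_add_atTop (X 0 ω)).congr fun n => ?_)
    refine Finset.sum_congr rfl fun k _ => ?_
    rw [← hX k]
    exact (hcond k (hpos k)).1.symm
  obtain ⟨n, hn⟩ := (mem_limsup_iff_frequently_mem.1 hmem).exists
  exact hne n hn
end

section
/- The biased random walk is not almost-surely terminating (Sections 5 and 7.2): Let (X_n)_{n∈ℕ} be an adapted process of ℕ-valued random variables with X_0 = 1 almost surely, such that for every n, almost surely on the event {X_n > 0}: ℙ(X_{n+1} = X_n − 1 ∣ ℱ_n) = 1/3 and ℙ(X_{n+1} = X_n + 1 ∣ ℱ_n) = 2/3, and on the event {X_n = 0}: X_{n+1} = 0 almost surely. Then ℙ(∃ n, X_n = 0) < 1. -/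
open MeasureTheory Filter

/-- If the conditional expectation of `f` equals the constant `c` wherever the `m'`-measurable
weight `a` does not vanish, then `f` may be replaced by `c` under the weighted integral. -/
theorem integral_mul_eq_of_condExp_eq_const {Ω : Type*} {m' m : MeasurableSpace Ω}
    {μ : Measure Ω} [IsFiniteMeasure μ] (hm : m' ≤ m) {a f : Ω → ℝ} {c : ℝ}
    (ha : StronglyMeasurable[m'] a) (hf : Integrable f μ) (haf : Integrable (a * f) μ)
    (hc : ∀ᵐ ω ∂μ, a ω ≠ 0 → (μ[f | m']) ω = c) :
    ∫ ω, a ω * f ω ∂μ = ∫ ω, a ω * c ∂μ := by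
  have hpull := condExp_mul_of_stronglyMeasurable_left ha haf hf
  calc ∫ ω, a ω * f ω ∂μ = ∫ ω, (μ[a * f | m']) ω ∂μ := (integral_condExp hm).symm
    _ = ∫ ω, a ω * c ∂μ := by
      refine integral_congr_ae ?_
      filter_upwards [hpull, hc] with ω h₁ h₂
      rw [h₁, Pi.mul_apply]
      by_cases h : a ω = 0
      · simp [h]
      · rw [h₂ h]

/-- One step of the biased walk does not increase the expectation of `2 ^ (-X)`. -/
theorem integral_half_pow_step_le {Ω : Type*} {m' m : MeasurableSpace Ω}
    {μ : Measure Ω} [IsProbabilityMeasure μ] (hm : m' ≤ m) {X Y : Ω → ℕ}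
    (hX : Measurable[m'] X) (hY : Measurable Y)
    (hstep : ∀ᵐ ω ∂μ, 0 < X ω →
      (μ[Set.indicator {ω' | Y ω' = X ω' - 1} (fun _ => (1 : ℝ)) | m']) ω = 1 / 3
        ∧ (μ[Set.indicator {ω' | Y ω' = X ω' + 1} (fun _ => (1 : ℝ)) | m']) ω = 2 / 3) :
    ∫ ω, (1 / 2 : ℝ) ^ Y ω ∂μ ≤ ∫ ω, (1 / 2 : ℝ) ^ X ω ∂μ := by
  have hXm : Measurable X := hX.mono hm le_rfl
  have hpow (k : ℕ) : 0 ≤ (1 / 2 : ℝ) ^ k ∧ (1 / 2 : ℝ) ^ k ≤ 1 :=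
    ⟨by positivity, pow_le_one₀ (by norm_num) (by norm_num)⟩
  set D : Set Ω := {ω | Y ω = X ω - 1} with hD
  set U : Set Ω := {ω | Y ω = X ω + 1} with hU
  have hDm : MeasurableSet D :=
    measurableSet_eq_fun hY ((measurable_of_countable fun k : ℕ => k - 1).comp hXm)
  have hUm : MeasurableSet U :=
    measurableSet_eq_fun hY ((measurable_of_countable fun k : ℕ => k + 1).comp hXm)
  let α : ℕ → ℝ := fun k => if k = 0 then 0 else 2 * (1 / 2) ^ k - 1
  let β : ℕ → ℝ := fun k => if k = 0 then 0 else (1 / 2) ^ k / 2 - 1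
  have hα (k : ℕ) : ‖α k‖ ≤ 1 := by
    obtain ⟨h₀, h₁⟩ := hpow k
    simp only [α, Real.norm_eq_abs, abs_le]
    split_ifs <;> constructor <;> linarith
  have hβ (k : ℕ) : ‖β k‖ ≤ 1 := by
    obtain ⟨h₀, h₁⟩ := hpow k
    simp only [β, Real.norm_eq_abs, abs_le]
    split_ifs <;> constructor <;> linarith
  have hint {Z : Ω → ℕ} (hZ : Measurable Z) (γ : ℕ → ℝ) (hγ : ∀ k, ‖γ k‖ ≤ 1) :
      Integrable (fun ω => γ (Z ω)) μ :=
    .of_bound ((measurable_of_countable γ).comp hZ).aestronglyMeasurable 1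
      (.of_forall fun _ => hγ _)
  have hpow' (k : ℕ) : ‖(1 / 2 : ℝ) ^ k‖ ≤ 1 := by
    rw [Real.norm_of_nonneg (hpow k).1]; exact (hpow k).2
  have hind {s : Set Ω} (hs : MeasurableSet s) :
      Integrable (s.indicator fun _ => (1 : ℝ)) μ := (integrable_const 1).indicator hs
  have hprod {s : Set Ω} (hs : MeasurableSet s) (γ : ℕ → ℝ) (hγ : ∀ k, ‖γ k‖ ≤ 1) :
      Integrable (fun ω => γ (X ω) * s.indicator (fun _ => (1 : ℝ)) ω) μ :=
    (hind hs).bdd_mul (hint hXm γ hγ).aestronglyMeasurable (.of_forall fun _ => hγ _)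
  have hmeas (γ : ℕ → ℝ) : StronglyMeasurable[m'] (fun ω => γ (X ω)) :=
    ((measurable_of_countable γ).comp hX).stronglyMeasurable
  have hdown : ∫ ω, α (X ω) * D.indicator (fun _ => (1 : ℝ)) ω ∂μ
      = ∫ ω, α (X ω) * (1 / 3) ∂μ := by
    refine integral_mul_eq_of_condExp_eq_const hm (hmeas α) (hind hDm) (hprod hDm α hα) ?_
    filter_upwards [hstep] with ω h hne
    exact (h (Nat.pos_of_ne_zero fun h0 => hne (by simp [α, h0]))).1
  have hup : ∫ ω, β (X ω) * U.indicator (fun _ => (1 : ℝ)) ω ∂μ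
      = ∫ ω, β (X ω) * (2 / 3) ∂μ := by
    refine integral_mul_eq_of_condExp_eq_const hm (hmeas β) (hind hUm) (hprod hUm β hβ) ?_
    filter_upwards [hstep] with ω h hne
    exact (h (Nat.pos_of_ne_zero fun h0 => hne (by simp [β, h0]))).2
  have hbound (ω : Ω) : (1 / 2 : ℝ) ^ Y ω ≤ 1 + α (X ω) * D.indicator (fun _ => (1 : ℝ)) ω
      + β (X ω) * U.indicator (fun _ => (1 : ℝ)) ω := by
    have hY1 := (hpow (Y ω)).2
    rcases Nat.eq_zero_or_eq_succ_pred (X ω) with h0 | hs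
    · simpa [α, β, h0] using hY1
    · generalize (X ω).pred = k at hs
      by_cases hd : Y ω = k
      · have hd' : ω ∈ D := by simp [hD, hs, hd]
        have hu' : ω ∉ U := by simp [hU, hs, hd, add_assoc]
        simp only [hd', hu', Set.indicator_of_mem, Set.indicator_of_notMem, not_false_eq_true,
          α, hs, hd, Nat.succ_ne_zero, if_false, pow_succ]
        linarith
      · have hd' : ω ∉ D := by simpa [hD, hs] using hd
        by_cases hu : Y ω = k + 2
        · have hu' : ω ∈ U := by simp [hU, hs, hu]
          simp only [hd', hu', Set.indicator_of_mem, Set.indicator_of_notMem, not_false_eq_true,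
            β, hs, hu, Nat.succ_ne_zero, if_false, pow_succ]
          linarith
        · have hu' : ω ∉ U := by simpa [hU, hs] using hu
          simpa [hd', hu'] using hY1
  have hsum : ∀ ω, 1 + α (X ω) * (1 / 3) + β (X ω) * (2 / 3) = (1 / 2 : ℝ) ^ X ω := by
    intro ω
    by_cases h0 : X ω = 0
    · simp [α, β, h0]
    · simp only [α, β, h0, if_false]
      ring
  have hone : Integrable (fun _ : Ω => (1 : ℝ)) μ := integrable_const 1
  have hsplit {f g : Ω → ℝ} (hf : Integrable f μ) (hg : Integrable g μ) :
      ∫ ω, (1 + f ω + g ω) ∂μ = ∫ _, (1 : ℝ) ∂μ + ∫ ω, f ω ∂μ + ∫ ω, g ω ∂μ := by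
    rw [← integral_add hone hf]
    exact integral_add (hone.add hf) hg
  calc ∫ ω, (1 / 2 : ℝ) ^ Y ω ∂μ
      ≤ ∫ ω, (1 + α (X ω) * D.indicator (fun _ => (1 : ℝ)) ω
          + β (X ω) * U.indicator (fun _ => (1 : ℝ)) ω) ∂μ :=
        integral_mono (hint hY _ hpow') ((hone.add (hprod hDm α hα)).add (hprod hUm β hβ)) hbound
    _ = ∫ ω, (1 + α (X ω) * (1 / 3) + β (X ω) * (2 / 3)) ∂μ := by
        rw [hsplit (hprod hDm α hα) (hprod hUm β hβ), hdown, hup,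
          hsplit ((hint hXm α hα).mul_const _) ((hint hXm β hβ).mul_const _)]
    _ = ∫ ω, (1 / 2 : ℝ) ^ X ω ∂μ := by simp_rw [hsum]

/-- The probability that an `ℕ`-valued variable vanishes is at most the expectation
of `2 ^ (-X)`. -/
theorem measureReal_eq_zero_le_integral_half_pow {Ω : Type*} {m : MeasurableSpace Ω}
    {μ : Measure Ω} [IsProbabilityMeasure μ] {X : Ω → ℕ} (hX : Measurable X) :
    μ.real {ω | X ω = 0} ≤ ∫ ω, (1 / 2 : ℝ) ^ X ω ∂μ := by
  have hs : MeasurableSet {ω | X ω = 0} := hX (measurableSet_singleton 0)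
  rw [← integral_indicator_one hs]
  refine integral_mono ((integrable_const 1).indicator hs) ?_ fun ω => ?_
  · refine .of_bound ((measurable_of_countable fun k : ℕ => (1 / 2 : ℝ) ^ k).comp
      hX).aestronglyMeasurable 1 (.of_forall fun ω => ?_)
    rw [Real.norm_of_nonneg (by positivity)]
    exact pow_le_one₀ (by norm_num) (by norm_num)
  · by_cases h : X ω = 0
    · simp [h]
    · simp [h]

/-- The biased random walk is not almost-surely terminating (Sections 5 and 7.2). -/
theorem stmt_13 {Ω : Type*} {m : MeasurableSpace Ω} {μ : Measure Ω} [IsProbabilityMeasure μ]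
    (ℱ : Filtration ℕ m) (X : ℕ → Ω → ℕ)
    (hadp : Adapted ℱ X)
    (hstart : ∀ᵐ ω ∂μ, X 0 ω = 1)
    (hstep : ∀ n : ℕ, ∀ᵐ ω ∂μ, 0 < X n ω →
      (μ[Set.indicator {ω' | X (n + 1) ω' = X n ω' - 1} (fun _ => (1 : ℝ)) | ℱ n]) ω
          = 1 / 3
        ∧ (μ[Set.indicator {ω' | X (n + 1) ω' = X n ω' + 1} (fun _ => (1 : ℝ)) | ℱ n]) ω
          = 2 / 3)
    (habsorb : ∀ n : ℕ, ∀ᵐ ω ∂μ, X n ω = 0 → X (n + 1) ω = 0) :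
    μ {ω | ∃ n, X n ω = 0} < 1 := by
  have hmeas (n : ℕ) : Measurable (X n) := (hadp n).mono (ℱ.le n) le_rfl
  have hexp (n : ℕ) : ∫ ω, (1 / 2 : ℝ) ^ X n ω ∂μ ≤ 1 / 2 := by
    induction n with
    | zero =>
      have h : ∫ ω, (1 / 2 : ℝ) ^ X 0 ω ∂μ = ∫ _, (1 / 2 : ℝ) ∂μ := by
        refine integral_congr_ae ?_
        filter_upwards [hstart] with ω hω
        rw [hω, pow_one]
      rw [h]
      simp
    | succ n ih =>
      exact (integral_half_pow_step_le (ℱ.le n) (hadp n) (hmeas (n + 1)) (hstep n)).trans ih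
  have hzero (n : ℕ) : μ {ω | X n ω = 0} ≤ ENNReal.ofReal (1 / 2) := by
    rw [← ofReal_measureReal]
    exact ENNReal.ofReal_le_ofReal
      ((measureReal_eq_zero_le_integral_half_pow (hmeas n)).trans (hexp n))
  have hacc (n : ℕ) : μ (Set.accumulate (fun k => {ω | X k ω = 0}) n) ≤ μ {ω | X n ω = 0} := by
    refine measure_mono_ae ?_
    filter_upwards [ae_all_iff.2 habsorb] with ω hω hmem
    obtain ⟨k, hk, h0⟩ := Set.mem_accumulate.1 hmem
    exact Nat.le_induction h0 (fun j _ hj => hω j hj) n hk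
  calc μ {ω | ∃ n, X n ω = 0} = μ (⋃ n, {ω | X n ω = 0}) := by rw [Set.ofPred_exists]
    _ = ⨆ n, μ (Set.accumulate (fun k => {ω | X k ω = 0}) n) :=
      measure_iUnion_eq_iSup_accumulate
    _ ≤ ENNReal.ofReal (1 / 2) := iSup_le fun n => (hacc n).trans (hzero n)
    _ < 1 := by
      rw [ENNReal.ofReal_lt_one]
      norm_num
end

section
/- Almost-sure termination of the Lazy Loper (Section 4.5): Let (X_n)_{n∈ℕ} be an adapted process of ℕ-valued random variables such that for every n, almost surely on the event {X_n > 0}: ℙ(X_{n+1} = X_n − 1 ∣ ℱ_n) = 1/(2·X_n), ℙ(X_{n+1} = X_n + 1 ∣ ℱ_n) = 1/(2·X_n), and ℙ(X_{n+1} = X_n ∣ ℱ_n) = 1 − 1/X_n. Then almost surely there exists n with X_n = 0. -/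
open MeasureTheory Filter

namespace LazyLoper

/-- An integrable function that is at most `1` on a set `A` of the sub-σ-algebra `m'` and whose
conditional expectation equals `1` on `A` is itself almost surely `1` on `A`. -/
theorem ae_eq_one_of_condExp_eq_one {Ω : Type*} {m' m : MeasurableSpace Ω} {μ : Measure Ω}
    [IsFiniteMeasure μ] (hm : m' ≤ m) {A : Set Ω} (hA : MeasurableSet[m'] A) {f : Ω → ℝ}
    (hf : Integrable f μ) (hle : ∀ ω ∈ A, f ω ≤ 1)
    (hcond : ∀ᵐ ω ∂μ, ω ∈ A → (μ[f | m']) ω = 1) :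
    ∀ᵐ ω ∂μ, ω ∈ A → f ω = 1 := by
  have hint : ∫ ω in A, (1 - f ω) ∂μ = 0 := by
    rw [integral_sub (integrable_const _) hf.integrableOn, ← setIntegral_condExp hm hf hA,
      setIntegral_congr_ae (g := fun _ => (1 : ℝ)) (hm _ hA) hcond, sub_self]
  have hnonneg : 0 ≤ᵐ[μ.restrict A] fun ω => 1 - f ω := by
    filter_upwards [ae_restrict_mem (hm _ hA)] with ω hω
    simpa using hle ω hω
  rw [setIntegral_eq_zero_iff_of_nonneg_ae hnonneg ((integrable_const _).sub hf).integrableOn]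
    at hint
  filter_upwards [(ae_restrict_iff' (hm _ hA)).1 hint] with ω hω hωA
  have := hω hωA
  simp only [Pi.zero_apply] at this
  linarith

/-- A sequence of natural numbers that converges in `ℝ` is eventually constant. -/
theorem eventually_const_of_tendsto_natCast {u : ℕ → ℕ} {l : ℝ}
    (h : Tendsto (fun n => (u n : ℝ)) atTop (nhds l)) : ∃ c, ∀ᶠ n in atTop, u n = c := by
  obtain ⟨c, rfl⟩ := Nat.isClosedEmbedding_coe_real.isClosed_range.mem_of_tendsto h
    (Eventually.of_forall fun n => Set.mem_range_self (u n))
  refine ⟨c, ?_⟩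
  have hu : Tendsto u atTop (nhds c) :=
    Nat.isClosedEmbedding_coe_real.isInducing.tendsto_nhds_iff.2 h
  rwa [nhds_discrete, tendsto_pure] at hu

/-- The one-step law of the lazy walk while it is positive. -/
def HasLazySteps {Ω : Type*} {m : MeasurableSpace Ω} (μ : Measure Ω) (ℱ : Filtration ℕ m)
    (X : ℕ → Ω → ℕ) : Prop :=
  ∀ n : ℕ, ∀ᵐ ω ∂μ, 0 < X n ω →
    (μ[Set.indicator {ω' | X (n + 1) ω' = X n ω' - 1} (fun _ => (1 : ℝ)) | ℱ n]) ω
        = 1 / (2 * (X n ω : ℝ))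
      ∧ (μ[Set.indicator {ω' | X (n + 1) ω' = X n ω' + 1} (fun _ => (1 : ℝ)) | ℱ n]) ω
        = 1 / (2 * (X n ω : ℝ))
      ∧ (μ[Set.indicator {ω' | X (n + 1) ω' = X n ω'} (fun _ => (1 : ℝ)) | ℱ n]) ω
        = 1 - 1 / (X n ω : ℝ)

/-- The event that the walk starts at or below `K` and is positive up to time `n`. -/
def aliveSet {Ω : Type*} (X : ℕ → Ω → ℕ) (K n : ℕ) : Set Ω :=
  {ω | X 0 ω ≤ K ∧ ∀ i ≤ n, 0 < X i ω}

/-- The walk started at or below `K` and absorbed at `0`. -/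
noncomputable def absorbed {Ω : Type*} (X : ℕ → Ω → ℕ) (K n : ℕ) : Ω → ℝ :=
  (aliveSet X K n).indicator fun ω => (X n ω : ℝ)

section

variable {Ω : Type*} {m : MeasurableSpace Ω} {μ : Measure Ω} [IsProbabilityMeasure μ]
  {ℱ : Filtration ℕ m} {X : ℕ → Ω → ℕ}

theorem measurableSet_transition (hadp : Adapted ℱ X) (g : ℕ → ℕ) (n : ℕ) :
    MeasurableSet[ℱ (n + 1)] {ω | X (n + 1) ω = g (X n ω)} :=
  measurableSet_eq_fun (hadp (n + 1))
    ((measurable_of_countable g).comp ((hadp n).mono (ℱ.mono n.le_succ) le_rfl))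

theorem integrable_transition (hadp : Adapted ℱ X) (g : ℕ → ℕ) (n : ℕ) :
    Integrable (Set.indicator {ω | X (n + 1) ω = g (X n ω)} fun _ => (1 : ℝ)) μ :=
  (integrable_const _).indicator (ℱ.le _ _ (measurableSet_transition hadp g n))

theorem measurableSet_aliveSet (hadp : Adapted ℱ X) (K n : ℕ) :
    MeasurableSet[ℱ n] (aliveSet X K n) := by
  have hpos : ∀ i ≤ n, MeasurableSet[ℱ n] {ω | 0 < X i ω} := fun i hi =>
    ℱ.mono hi _ (hadp i (measurableSet_Ioi (a := 0)))
  have hstart : MeasurableSet[ℱ n] {ω | X 0 ω ≤ K} :=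
    ℱ.mono n.zero_le _ (hadp 0 (measurableSet_Iic (a := K)))
  have : aliveSet X K n = {ω | X 0 ω ≤ K} ∩ ⋂ i, ⋂ (_ : i ≤ n), {ω | 0 < X i ω} := by
    ext; simp [aliveSet]
  rw [this]
  exact hstart.inter (MeasurableSet.iInter fun i => MeasurableSet.iInter (hpos i))

/-- While positive, the walk almost surely moves by at most one. -/
theorem ae_step (hadp : Adapted ℱ X) (hstep : HasLazySteps μ ℱ X) (n : ℕ) :
    ∀ᵐ ω ∂μ, 0 < X n ω →
      X (n + 1) ω = X n ω - 1 ∨ X (n + 1) ω = X n ω + 1 ∨ X (n + 1) ω = X n ω := by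
  have hD := integrable_transition (μ := μ) hadp (· - 1) n
  have hU := integrable_transition (μ := μ) hadp (· + 1) n
  have hS := integrable_transition (μ := μ) hadp id n
  have key := ae_eq_one_of_condExp_eq_one (ℱ.le n) (A := {ω | 0 < X n ω})
    (hadp n (measurableSet_Ioi (a := 0))) ((hD.add hU).add hS) ?_ ?_
  · filter_upwards [key] with ω hω hpos
    have := hω hpos
    by_contra! hne
    simp [Set.indicator, hne.1, hne.2.1, hne.2.2] at this
  · intro ω hω
    have hω : 0 < X n ω := hω
    simp only [Pi.add_apply, Set.indicator, Set.mem_ofPred_eq, id]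
    split_ifs <;> first | omega | norm_num
  · filter_upwards [hstep n, condExp_add (hD.add hU) hS (ℱ n), condExp_add hD hU (ℱ n)]
      with ω h h₁ h₂ hpos
    obtain ⟨hd, hu, hs⟩ := h hpos
    have hx : (X n ω : ℝ) ≠ 0 := Nat.cast_ne_zero.2 (ne_of_gt hpos)
    rw [h₁, Pi.add_apply, h₂, Pi.add_apply]
    simp only [id] at hd hu hs ⊢
    rw [hd, hu, hs]
    field_simp
    ring

/-- One step of the absorbed walk adds the difference of the up and down indicators. -/
theorem absorbed_succ (hadp : Adapted ℱ X) (hstep : HasLazySteps μ ℱ X) (K n : ℕ) :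
    absorbed X K (n + 1) =ᵐ[μ] absorbed X K n + (aliveSet X K n).indicator
      (Set.indicator {ω | X (n + 1) ω = X n ω + 1} (fun _ => (1 : ℝ))
        - Set.indicator {ω | X (n + 1) ω = X n ω - 1} (fun _ => (1 : ℝ))) := by
  filter_upwards [ae_step hadp hstep n] with ω hω
  by_cases hA : ω ∈ aliveSet X K n
  · have hpos : 0 < X n ω := hA.2 n le_rfl
    have hsucc : absorbed X K (n + 1) ω = X (n + 1) ω := by
      by_cases h : ω ∈ aliveSet X K (n + 1)
      · simp [absorbed, h]
      · have h0 : X (n + 1) ω = 0 := by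
          by_contra hne
          refine h ⟨hA.1, fun i hi => ?_⟩
          rcases Nat.le_succ_iff.1 hi with hi | rfl
          · exact hA.2 i hi
          · exact Nat.pos_of_ne_zero hne
        simp [absorbed, h, h0]
    rw [hsucc]
    rw [Pi.add_apply, absorbed, Set.indicator_of_mem hA, Set.indicator_of_mem hA]
    simp only [Pi.sub_apply, Set.indicator, Set.mem_ofPred_eq]
    rcases hω hpos with h | h | h
    · rw [h, if_neg (by omega), if_pos rfl, Nat.cast_sub hpos]
      push_cast
      ring
    · rw [h, if_pos rfl, if_neg (by omega)]
      push_cast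
      ring
    · rw [h, if_neg (by omega), if_neg (by omega)]
      ring
  · have h : ω ∉ aliveSet X K (n + 1) := fun h =>
      hA ⟨h.1, fun i hi => h.2 i (hi.trans n.le_succ)⟩
    simp [absorbed, hA, h]

theorem integrable_absorbed (hadp : Adapted ℱ X) (hstep : HasLazySteps μ ℱ X) (K n : ℕ) :
    Integrable (absorbed X K n) μ := by
  induction n with
  | zero =>
    refine Integrable.of_bound (C := K) ?_ (Eventually.of_forall fun ω => ?_)
    · exact ((measurable_of_countable _).comp ((hadp 0).mono (ℱ.le 0) le_rfl)
        |>.indicator (ℱ.le 0 _ (measurableSet_aliveSet hadp K 0))).aestronglyMeasurable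
    · by_cases h : ω ∈ aliveSet X K 0
      · simpa [absorbed, h] using h.1
      · simp [absorbed, h]
  | succ n ih =>
    refine (ih.add (Integrable.indicator ?_ (ℱ.le n _ (measurableSet_aliveSet hadp K n)))).congr
      (absorbed_succ hadp hstep K n).symm
    exact (integrable_transition hadp (· + 1) n).sub (integrable_transition hadp (· - 1) n)

theorem martingale_absorbed (hadp : Adapted ℱ X) (hstep : HasLazySteps μ ℱ X) (K : ℕ) :
    Martingale (absorbed X K) ℱ μ := by
  have hmeas : StronglyAdapted ℱ (absorbed X K) := fun n =>
    (((measurable_of_countable _).comp (hadp n)).indicator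
      (measurableSet_aliveSet hadp K n)).stronglyMeasurable
  refine martingale_nat hmeas (integrable_absorbed hadp hstep K) fun n => ?_
  have hU := integrable_transition (μ := μ) hadp (· + 1) n
  have hD := integrable_transition (μ := μ) hadp (· - 1) n
  have hA := measurableSet_aliveSet hadp K n
  have hself : μ[absorbed X K n | ℱ n] = absorbed X K n :=
    condExp_of_stronglyMeasurable (ℱ.le n) (hmeas n) (integrable_absorbed hadp hstep K n)
  filter_upwards [condExp_congr_ae (m := ℱ n) (absorbed_succ hadp hstep K n),
    condExp_add (integrable_absorbed hadp hstep K n)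
      ((hU.sub hD).indicator (ℱ.le n _ hA)) (ℱ n),
    condExp_indicator (hU.sub hD) hA, condExp_sub hU hD (ℱ n), hstep n] with ω h₁ h₂ h₃ h₄ h₅
  rw [h₁, h₂, Pi.add_apply, hself, h₃]
  by_cases hω : ω ∈ aliveSet X K n
  · obtain ⟨hd, hu, -⟩ := h₅ (hω.2 n le_rfl)
    rw [Set.indicator_of_mem hω, h₄, Pi.sub_apply, hd, hu, sub_self, add_zero]
  · rw [Set.indicator_of_notMem hω, add_zero]

theorem absorbed_nonneg (K n : ℕ) (ω : Ω) : 0 ≤ absorbed X K n ω :=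
  Set.indicator_nonneg (fun _ _ => Nat.cast_nonneg _) ω

theorem ae_exists_tendsto_absorbed (hadp : Adapted ℱ X) (hstep : HasLazySteps μ ℱ X) (K : ℕ) :
    ∀ᵐ ω ∂μ, ∃ l, Tendsto (fun n => absorbed X K n ω) atTop (nhds l) := by
  have hM := martingale_absorbed hadp hstep K
  have hbdd : ∀ n, eLpNorm (absorbed X K n) 1 μ
      ≤ ((∫ ω, absorbed X K 0 ω ∂μ).toNNReal : ENNReal) := fun n => by
    have hint : ∫ ω, absorbed X K n ω ∂μ = ∫ ω, absorbed X K 0 ω ∂μ := by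
      rw [← integral_condExp (ℱ.le 0), integral_congr_ae (hM.2 0 n n.zero_le)]
    rw [eLpNorm_one_eq_lintegral_enorm, ← ofReal_integral_norm_eq_lintegral_enorm (hM.integrable n)]
    simp only [Real.norm_of_nonneg (absorbed_nonneg K n _), hint]
    rfl
  filter_upwards [hM.submartingale.ae_tendsto_limitProcess hbdd] with ω hω using ⟨_, hω⟩

/-- While positive, the walk almost surely does not stabilise. -/
theorem ae_not_eventually_const (hadp : Adapted ℱ X) (hstep : HasLazySteps μ ℱ X) :
    ∀ᵐ ω ∂μ, ∀ c, 0 < c → ¬ ∀ᶠ n in atTop, X n ω = c := by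
  let s : ℕ → Set Ω := fun n => Nat.casesOn n ∅ fun k => {ω | X (k + 1) ω = X k ω + 1}
  have hs : ∀ n, MeasurableSet[ℱ n] (s n) := by
    rintro (_ | k)
    · exact @MeasurableSet.empty _ (ℱ 0)
    · exact measurableSet_transition hadp (· + 1) k
  filter_upwards [ae_mem_limsup_atTop_iff μ hs, ae_all_iff.2 hstep] with ω hω hlaw c hc hconst
  obtain ⟨N, hN⟩ := eventually_atTop.1 hconst
  have hnot : ω ∉ limsup s atTop := by
    rw [mem_limsup_iff_frequently_mem, not_frequently]
    filter_upwards [eventually_ge_atTop (N + 1)] with n hn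
    obtain ⟨k, rfl⟩ : ∃ k, n = k + 1 := ⟨n - 1, by omega⟩
    change ¬ X (k + 1) ω = X k ω + 1
    rw [hN k (by omega), hN (k + 1) (by omega)]
    omega
  refine hnot (hω.2 ?_)
  rw [← tendsto_add_atTop_iff_nat N]
  have hsum : ∀ n, ∑ k ∈ Finset.range (n + N), (μ[(s (k + 1)).indicator (1 : Ω → ℝ) | ℱ k]) ω
      = (n : ℝ) * (1 / (2 * c)) + ∑ k ∈ Finset.range N,
        (μ[(s (k + 1)).indicator (1 : Ω → ℝ) | ℱ k]) ω := fun n => by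
    induction n with
    | zero => simp
    | succ n ih =>
      have hX : X (n + N) ω = c := hN _ (by omega)
      have hlast : (μ[(s (n + N + 1)).indicator (1 : Ω → ℝ) | ℱ (n + N)]) ω = 1 / (2 * c) := by
        have := (hlaw (n + N) (hX ▸ hc)).2.1
        rwa [hX] at this
      rw [Nat.add_right_comm, Finset.sum_range_succ, ih, hlast]
      push_cast
      ring
  simp only [hsum]
  refine tendsto_atTop_add_const_right _ _ (tendsto_natCast_atTop_atTop.atTop_mul_const ?_)
  positivity

end

end LazyLoper

/-- Almost-sure termination of the Lazy Loper (Section 4.5). -/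
theorem stmt_14 {Ω : Type*} {m : MeasurableSpace Ω} {μ : Measure Ω} [IsProbabilityMeasure μ]
    (ℱ : Filtration ℕ m) (X : ℕ → Ω → ℕ)
    (hadp : Adapted ℱ X)
    (hstep : ∀ n : ℕ, ∀ᵐ ω ∂μ, 0 < X n ω →
      (μ[Set.indicator {ω' | X (n + 1) ω' = X n ω' - 1} (fun _ => (1 : ℝ)) | ℱ n]) ω
          = 1 / (2 * (X n ω : ℝ))
        ∧ (μ[Set.indicator {ω' | X (n + 1) ω' = X n ω' + 1} (fun _ => (1 : ℝ)) | ℱ n]) ω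
          = 1 / (2 * (X n ω : ℝ))
        ∧ (μ[Set.indicator {ω' | X (n + 1) ω' = X n ω'} (fun _ => (1 : ℝ)) | ℱ n]) ω
          = 1 - 1 / (X n ω : ℝ)) :
    ∀ᵐ ω ∂μ, ∃ n, X n ω = 0 := by
  filter_upwards [ae_all_iff.2 (LazyLoper.ae_exists_tendsto_absorbed hadp hstep),
    LazyLoper.ae_not_eventually_const hadp hstep] with ω hconv hmove
  by_contra! hpos
  have halive : ∀ n, ω ∈ LazyLoper.aliveSet X (X 0 ω) n := fun n =>
    ⟨le_rfl, fun i _ => Nat.pos_of_ne_zero (hpos i)⟩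
  obtain ⟨l, hl⟩ := hconv (X 0 ω)
  simp only [LazyLoper.absorbed, Set.indicator_of_mem (halive _)] at hl
  obtain ⟨c, hc⟩ := LazyLoper.eventually_const_of_tendsto_natCast hl
  obtain ⟨n, hn⟩ := hc.exists
  exact hmove c (hn ▸ Nat.pos_of_ne_zero (hpos n)) hc
end

section
/- Almost-sure termination of the Very Lazy Loper (Section 4.6): Let ((X_n, N_n))_{n∈ℕ} be an adapted process of ℕ×ℕ-valued random variables with N_0 ≥ 1 almost surely, such that for every n, almost surely on the event {X_n > 0}: ℙ((X_{n+1}, N_{n+1}) = (X_n − 1, N_n) ∣ ℱ_n) = 1/(2·N_n), ℙ((X_{n+1}, N_{n+1}) = (X_n + 1, N_n) ∣ ℱ_n) = 1/(2·N_n), and ℙ((X_{n+1}, N_{n+1}) = (X_n, N_n + 1) ∣ ℱ_n) = 1 − 1/N_n. Then almost surely there exists n with X_n = 0. -/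
open MeasureTheory Filter

/-- A nonnegative function whose conditional expectation vanishes on a measurable event vanishes
almost surely on that event. -/
theorem ae_eq_zero_on_of_condExp_eq_zero {Ω : Type*} {m m₀ : MeasurableSpace Ω} {μ : Measure Ω}
    [IsFiniteMeasure μ] (hm : m ≤ m₀) {h : Ω → ℝ} (hf_int : Integrable h μ) {A : Set Ω}
    (hA : MeasurableSet[m] A) (hnonneg : ∀ ω ∈ A, 0 ≤ h ω)
    (hzero : ∀ᵐ ω ∂μ, ω ∈ A → (μ[h | m]) ω = 0) :
    ∀ᵐ ω ∂μ, ω ∈ A → h ω = 0 := by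
  have hintegral : ∫ ω, A.indicator h ω ∂μ = 0 := by
    rw [integral_indicator (hm A hA), ← setIntegral_condExp hm hf_int hA,
      ← integral_indicator (hm A hA)]
    refine integral_eq_zero_of_ae ?_
    filter_upwards [hzero] with ω hω
    by_cases hωA : ω ∈ A <;> simp [hωA, hω]
  rw [integral_eq_zero_iff_of_nonneg (fun ω => Set.indicator_nonneg hnonneg ω)
    (hf_int.indicator (hm A hA))] at hintegral
  filter_upwards [hintegral] with ω hω hωA
  simpa [hωA] using hω

/-- A nonnegative martingale converges almost surely. -/
theorem Martingale.exists_ae_tendsto_of_nonneg {Ω : Type*} {m : MeasurableSpace Ω}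
    {μ : Measure Ω} [IsFiniteMeasure μ] {ℱ : Filtration ℕ m} {Z : ℕ → Ω → ℝ}
    (hZ : Martingale Z ℱ μ) (hnonneg : ∀ n ω, 0 ≤ Z n ω) :
    ∀ᵐ ω ∂μ, ∃ c, Tendsto (fun n => Z n ω) atTop (nhds c) := by
  refine hZ.submartingale.exists_ae_tendsto_of_bdd (R := (∫ ω, Z 0 ω ∂μ).toNNReal) fun n => ?_
  have hmean : ∫ ω, Z n ω ∂μ = ∫ ω, Z 0 ω ∂μ := by
    simpa using (hZ.setIntegral_eq (Nat.zero_le n) MeasurableSet.univ).symm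
  rw [eLpNorm_one_eq_lintegral_enorm, ← hmean, ← ENNReal.ofReal,
    ofReal_integral_eq_lintegral_ofReal (hZ.integrable n) (ae_of_all _ (hnonneg n))]
  refine le_of_eq (lintegral_congr fun ω => ?_)
  rw [Real.enorm_eq_ofReal (hnonneg n ω)]

/-- A sequence of natural numbers that converges in the reals is eventually constant. -/
theorem eventually_succ_eq_of_tendsto_natCast {x : ℕ → ℕ} {c : ℝ}
    (h : Tendsto (fun n => (x n : ℝ)) atTop (nhds c)) : ∀ᶠ n in atTop, x (n + 1) = x n := by
  have hdiff : Tendsto (fun n => (x (n + 1) : ℝ) - x n) atTop (nhds 0) := by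
    simpa using (h.comp (tendsto_add_atTop_nat 1)).sub h
  filter_upwards [hdiff.eventually (Ioo_mem_nhds (by norm_num : (-1 : ℝ) < 0) one_pos)]
    with n hn
  have h₁ : x n < x (n + 1) + 1 := by exact_mod_cast (by linarith [hn.1] :
    (x n : ℝ) < x (n + 1) + 1)
  have h₂ : x (n + 1) < x n + 1 := by exact_mod_cast (by linarith [hn.2] :
    (x (n + 1) : ℝ) < x n + 1)
  omega

/-- A positive sequence of naturals growing by at most one per step has a divergent sum of
reciprocals. -/
theorem tendsto_sum_one_div_two_mul_atTop {a : ℕ → ℕ} (hpos : ∀ n, 1 ≤ a n)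
    (hgrow : ∀ n, a (n + 1) ≤ a n + 1) :
    Tendsto (fun n => ∑ k ∈ Finset.range n, 1 / (2 * (a k : ℝ))) atTop atTop := by
  have hle : ∀ n, a n ≤ a 0 + n := fun n => by
    induction n with
    | zero => simp
    | succ n ih => have := hgrow n; omega
  rw [← not_summable_iff_tendsto_nat_atTop_of_nonneg (fun n => by positivity)]
  intro hsum
  refine mt (summable_nat_add_iff (f := fun n : ℕ => 1 / (n : ℝ)) (a 0)).1
    Real.not_summable_one_div_natCast ?_
  refine (hsum.mul_left 2).of_nonneg_of_le (fun n => by positivity) fun n => ?_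
  have hn : (0 : ℝ) < a n := by exact_mod_cast hpos n
  have hn' : (a n : ℝ) ≤ (n + a 0 : ℕ) := by exact_mod_cast (hle n).trans (by omega)
  calc (1 : ℝ) / (n + a 0 : ℕ) ≤ 1 / a n := one_div_le_one_div_of_le hn hn'
    _ = 2 * (1 / (2 * (a n : ℝ))) := by field_simp

/-- An integer-valued process that, while positive, moves up with the same conditional probability
as it moves down and otherwise stays put is almost surely eventually constant unless it hits
zero. -/
theorem ae_eventually_succ_eq_of_symmetric_steps {Ω : Type*} {m : MeasurableSpace Ω}
    {μ : Measure Ω} [IsFiniteMeasure μ] (ℱ : Filtration ℕ m) {X : ℕ → Ω → ℕ}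
    (hX : ∀ n, Measurable[ℱ n] (X n)) {D U : ℕ → Set Ω}
    (hD : ∀ n, MeasurableSet (D n)) (hU : ∀ n, MeasurableSet (U n))
    (hincr : ∀ n, ∀ᵐ ω ∂μ, 0 < X n ω → (X (n + 1) ω : ℝ) =
      X n ω + ((U n).indicator (fun _ => (1 : ℝ)) ω - (D n).indicator (fun _ => (1 : ℝ)) ω))
    (hsymm : ∀ n, ∀ᵐ ω ∂μ, 0 < X n ω → (μ[(U n).indicator (fun _ => (1 : ℝ)) | ℱ n]) ω =
      (μ[(D n).indicator (fun _ => (1 : ℝ)) | ℱ n]) ω) :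
    ∀ᵐ ω ∂μ, (∀ n, 0 < X n ω) → ∀ᶠ n in atTop, X (n + 1) ω = X n ω := by
  suffices hconv : ∀ K : ℕ, ∀ᵐ ω ∂μ, X 0 ω ≤ K → (∀ n, 0 < X n ω) →
      ∀ᶠ n in atTop, X (n + 1) ω = X n ω by
    filter_upwards [ae_all_iff.2 hconv] with ω hω using hω (X 0 ω) le_rfl
  intro K
  let A : ℕ → Set Ω := fun n => {ω | X 0 ω ≤ K ∧ ∀ i ≤ n, 0 < X i ω}
  let Z : ℕ → Ω → ℝ := fun n => (A n).indicator fun ω => (X n ω : ℝ)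
  let δ : ℕ → Ω → ℝ := fun n =>
    (U n).indicator (fun _ => (1 : ℝ)) - (D n).indicator (fun _ => (1 : ℝ))
  have hUint : ∀ n, Integrable ((U n).indicator (fun _ => (1 : ℝ))) μ :=
    fun n => (integrable_const 1).indicator (hU n)
  have hDint : ∀ n, Integrable ((D n).indicator (fun _ => (1 : ℝ))) μ :=
    fun n => (integrable_const 1).indicator (hD n)
  have hδint : ∀ n, Integrable (δ n) μ := fun n => (hUint n).sub (hDint n)
  have hA : ∀ n, MeasurableSet[ℱ n] (A n) := fun n => by
    refine MeasurableSet.inter ?_ ?_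
    · exact ℱ.mono (Nat.zero_le n) _ (hX 0 measurableSet_Iic)
    · have : {ω | ∀ i ≤ n, 0 < X i ω} = ⋂ i ∈ Set.Iic n, X i ⁻¹' Set.Ioi 0 := by
        ext ω; simp
      change MeasurableSet[ℱ n] {ω | ∀ i ≤ n, 0 < X i ω}
      rw [this]
      exact MeasurableSet.biInter (Set.to_countable _) fun i hi =>
        ℱ.mono hi _ (hX i measurableSet_Ioi)
  have hZmeas : StronglyAdapted ℱ Z := fun n =>
    ((measurable_from_top.comp (hX n)).indicator (hA n)).stronglyMeasurable
  have hZstep : ∀ n, Z (n + 1) =ᵐ[μ] Z n + (A n).indicator (δ n) := fun n => by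
    filter_upwards [hincr n] with ω hω
    by_cases hωA : ω ∈ A n
    · have hZsucc : Z (n + 1) ω = X (n + 1) ω := by
        by_cases hpos : 0 < X (n + 1) ω
        · refine Set.indicator_of_mem (show ω ∈ A (n + 1) from ⟨hωA.1, fun i hi => ?_⟩) _
          rcases Nat.le_succ_iff.1 hi with h | rfl
          · exact hωA.2 i h
          · exact hpos
        · have hnot : ω ∉ A (n + 1) := fun h => hpos (h.2 _ le_rfl)
          rw [show Z (n + 1) ω = 0 from Set.indicator_of_notMem hnot _]
          simp [Nat.eq_zero_of_not_pos hpos]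
      rw [hZsucc, hω (hωA.2 n le_rfl)]
      simp [Z, δ, hωA]
    · have hnot : ω ∉ A (n + 1) := fun h => hωA ⟨h.1, fun i hi => h.2 i (by omega)⟩
      simp [Z, hωA, hnot]
  have hZint : ∀ n, Integrable (Z n) μ := fun n => by
    induction n with
    | zero =>
      refine Integrable.of_bound ((hZmeas 0).mono (ℱ.le 0)).aestronglyMeasurable (K : ℝ)
        (ae_of_all _ fun ω => ?_)
      by_cases hωA : ω ∈ A 0
      · simpa [Z, hωA] using hωA.1
      · simp [Z, hωA]
    | succ n ih =>
      exact (ih.add ((hδint n).indicator (ℱ.le n _ (hA n)))).congr (hZstep n).symm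
  have hmart : Martingale Z ℱ μ := by
    refine martingale_nat hZmeas hZint fun n => ?_
    have hadd := condExp_add (hZint n) ((hδint n).indicator (ℱ.le n _ (hA n))) (ℱ n)
    have hself := condExp_of_stronglyMeasurable (ℱ.le n) (hZmeas n) (hZint n)
    filter_upwards [condExp_congr_ae (m := ℱ n) (hZstep n), hadd,
      condExp_indicator (hδint n) (hA n), condExp_sub (hUint n) (hDint n) (ℱ n), hsymm n]
      with ω h₁ h₂ h₃ h₄ h₅
    rw [h₁, h₂, Pi.add_apply, hself, h₃]
    by_cases hωA : ω ∈ A n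
    · rw [Set.indicator_of_mem hωA]
      simp only [δ]
      rw [h₄, Pi.sub_apply, h₅ (hωA.2 n le_rfl), sub_self, add_zero]
    · rw [Set.indicator_of_notMem hωA, add_zero]
  filter_upwards [Martingale.exists_ae_tendsto_of_nonneg hmart
    fun n ω => Set.indicator_nonneg (fun _ _ => Nat.cast_nonneg _) ω] with ω ⟨c, hc⟩ hK hpos
  refine eventually_succ_eq_of_tendsto_natCast (x := fun n => X n ω) (hc.congr fun n => ?_)
  exact Set.indicator_of_mem (show ω ∈ A n from ⟨hK, fun i _ => hpos i⟩) _

/-- Almost-sure termination of the Very Lazy Loper (Section 4.6). -/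
theorem stmt_17 {Ω : Type*} {m : MeasurableSpace Ω} {μ : Measure Ω} [IsProbabilityMeasure μ]
    (ℱ : Filtration ℕ m) (X N : ℕ → Ω → ℕ)
    (hadp : Adapted ℱ (fun n ω => (X n ω, N n ω)))
    (hstart : ∀ᵐ ω ∂μ, 1 ≤ N 0 ω)
    (hstep : ∀ n : ℕ, ∀ᵐ ω ∂μ, 0 < X n ω →
      (μ[Set.indicator {ω' | X (n + 1) ω' = X n ω' - 1 ∧ N (n + 1) ω' = N n ω'}
          (fun _ => (1 : ℝ)) | ℱ n]) ω = 1 / (2 * (N n ω : ℝ))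
        ∧ (μ[Set.indicator {ω' | X (n + 1) ω' = X n ω' + 1 ∧ N (n + 1) ω' = N n ω'}
            (fun _ => (1 : ℝ)) | ℱ n]) ω = 1 / (2 * (N n ω : ℝ))
        ∧ (μ[Set.indicator {ω' | X (n + 1) ω' = X n ω' ∧ N (n + 1) ω' = N n ω' + 1}
            (fun _ => (1 : ℝ)) | ℱ n]) ω = 1 - 1 / (N n ω : ℝ)) :
    ∀ᵐ ω ∂μ, ∃ n, X n ω = 0 := by
  have hXm : ∀ n, Measurable[ℱ n] (X n) := fun n => measurable_fst.comp (hadp n)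
  have hpair : ∀ n (f : ℕ → ℕ) (g : ℕ → ℕ), MeasurableSet[ℱ (n + 1)]
      {ω | X (n + 1) ω = f (X n ω) ∧ N (n + 1) ω = g (N n ω)} := fun n f g => by
    have hprev := (hadp n).mono (ℱ.mono n.le_succ) le_rfl
    have hjoint : Measurable[ℱ (n + 1)] fun ω => ((X (n + 1) ω, N (n + 1) ω), (X n ω, N n ω)) :=
      (hadp (n + 1)).prodMk hprev
    exact hjoint (MeasurableSet.of_discrete (s := {p : (ℕ × ℕ) × (ℕ × ℕ) |
      p.1.1 = f p.2.1 ∧ p.1.2 = g p.2.2}))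
  set D : ℕ → Set Ω := fun n => {ω | X (n + 1) ω = X n ω - 1 ∧ N (n + 1) ω = N n ω} with hDdef
  set U : ℕ → Set Ω := fun n => {ω | X (n + 1) ω = X n ω + 1 ∧ N (n + 1) ω = N n ω} with hUdef
  set S : ℕ → Set Ω := fun n => {ω | X (n + 1) ω = X n ω ∧ N (n + 1) ω = N n ω + 1} with hSdef
  have hDm : ∀ n, MeasurableSet[ℱ (n + 1)] (D n) := fun n => hpair n (· - 1) id
  have hUm : ∀ n, MeasurableSet[ℱ (n + 1)] (U n) := fun n => hpair n (· + 1) id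
  have hSm : ∀ n, MeasurableSet[ℱ (n + 1)] (S n) := fun n => hpair n id (· + 1)
  have hindicator : ∀ {B : Set Ω} {n : ℕ}, MeasurableSet[ℱ n] B →
      Integrable (B.indicator fun _ => (1 : ℝ)) μ :=
    fun {B n} hB => (integrable_const 1).indicator (ℱ.le n B hB)
  have hcases : ∀ n, ∀ᵐ ω ∂μ, 0 < X n ω → ω ∈ D n ∨ ω ∈ U n ∨ ω ∈ S n := fun n => by
    have hDUint := (hindicator (hDm n)).add (hindicator (hUm n))
    have hsumint := hDUint.add (hindicator (hSm n))
    have hzero := ae_eq_zero_on_of_condExp_eq_zero (ℱ.le n) ((integrable_const 1).sub hsumint)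
      (hXm n (measurableSet_Ioi (a := 0))) (fun ω hω => ?_) ?_
    · filter_upwards [hzero] with ω hω hpos
      by_contra! hnot
      have := hω hpos
      simp [hnot.1, hnot.2.1, hnot.2.2] at this
    · have hpos : 0 < X n ω := hω
      simp only [Pi.sub_apply, Pi.add_apply, Set.indicator_apply, hDdef, hUdef, hSdef,
        Set.mem_ofPred_eq]
      split_ifs <;> first | (exfalso; omega) | norm_num
    · filter_upwards [hstep n, condExp_sub (integrable_const (1 : ℝ)) hsumint (ℱ n),
        condExp_add hDUint (hindicator (hSm n)) (ℱ n),
        condExp_add (hindicator (hDm n)) (hindicator (hUm n)) (ℱ n)] with ω h₁ h₂ h₃ h₄ hω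
      obtain ⟨hd, hu, hs⟩ := h₁ hω
      rw [h₂, Pi.sub_apply, h₃, Pi.add_apply, h₄, Pi.add_apply, hd, hu, hs,
        condExp_const (ℱ.le n)]
      ring
  have hconst := ae_eventually_succ_eq_of_symmetric_steps ℱ (μ := μ) hXm
    (fun n => ℱ.le _ _ (hDm n)) (fun n => ℱ.le _ _ (hUm n))
    (fun n => by
      filter_upwards [hcases n] with ω hω hpos
      have hcast : ((X n ω - 1 : ℕ) : ℝ) = X n ω - 1 := Nat.cast_pred hpos
      rcases hω hpos with h | h | h
      · have hnot : ω ∉ U n := fun h' => by have := h.1; have := h'.1; omega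
        rw [Set.indicator_of_mem h, Set.indicator_of_notMem hnot, h.1, hcast]
        ring
      · have hnot : ω ∉ D n := fun h' => by have := h.1; have := h'.1; omega
        rw [Set.indicator_of_mem h, Set.indicator_of_notMem hnot, h.1]
        push_cast
        ring
      · have hnotU : ω ∉ U n := fun h' => by have := h.1; have := h'.1; omega
        have hnotD : ω ∉ D n := fun h' => by have := h.1; have := h'.1; omega
        rw [Set.indicator_of_notMem hnotU, Set.indicator_of_notMem hnotD, h.1]
        ring)
    (fun n => by
      filter_upwards [hstep n] with ω hω hpos
      rw [(hω hpos).1, (hω hpos).2.1])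
  have hBC := ae_mem_limsup_atTop_iff (ℱ := ℱ) μ (s := fun n => Nat.casesOn n ∅ D)
    (fun n => by cases n with
      | zero => exact @MeasurableSet.empty Ω (ℱ 0)
      | succ n => exact hDm n)
  filter_upwards [hstart, ae_all_iff.2 hstep, ae_all_iff.2 hcases, hconst, hBC]
    with ω hN₀ hω hωcases hωconst hωBC
  by_contra! hne
  have hpos : ∀ n, 0 < X n ω := fun n => Nat.pos_of_ne_zero (hne n)
  have hNstep : ∀ n, N n ω ≤ N (n + 1) ω ∧ N (n + 1) ω ≤ N n ω + 1 := fun n => by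
    rcases hωcases n (hpos n) with h | h | h <;> have := h.2 <;> omega
  have hNpos : ∀ n, 1 ≤ N n ω := fun n => by
    induction n with
    | zero => exact hN₀
    | succ n ih => exact ih.trans (hNstep n).1
  have hfreq := hωBC.2 ((tendsto_sum_one_div_two_mul_atTop hNpos fun n => (hNstep n).2).congr
    fun n => Finset.sum_congr rfl fun k _ => (hω k (hpos k)).1.symm)
  rw [mem_limsup_iff_frequently_mem] at hfreq
  obtain ⟨M, hM⟩ := eventually_atTop.1 (hωconst hpos)
  obtain ⟨k, hk, hkD⟩ := frequently_atTop.1 hfreq (M + 1)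
  obtain ⟨j, rfl⟩ : ∃ j, k = j + 1 := ⟨k - 1, by omega⟩
  have hdown : X (j + 1) ω = X j ω - 1 := hkD.1
  have hstay := hM j (by omega)
  have := hpos j
  omega
end

section
/- Termination probability of the recursive procedure P′ (Section 4.2): the least element of the set {t ∈ ℝ : 0 ≤ t ≤ 1 and t = 1/2 + t³/2} is (√5 − 1)/2; in particular this least fixed point is strictly less than 1. -/
/-- Termination probability of the recursive procedure P′ (Section 4.2):
the least fixed point in [0,1] of t ↦ 1/2 + t³/2 is (√5 − 1)/2, which is < 1. -/
theorem stmt_19 :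
    IsLeast {t : ℝ | 0 ≤ t ∧ t ≤ 1 ∧ t = 1 / 2 + t ^ 3 / 2} ((Real.sqrt 5 - 1) / 2)
      ∧ (Real.sqrt 5 - 1) / 2 < 1 := by
  have hsq : Real.sqrt 5 ^ 2 = 5 := Real.sq_sqrt (by norm_num)
  have hnonneg : 0 ≤ Real.sqrt 5 := Real.sqrt_nonneg 5
  have hone : 1 ≤ Real.sqrt 5 := by nlinarith
  have hthree : Real.sqrt 5 < 3 := by nlinarith
  refine ⟨⟨⟨by linarith, by linarith, ?_⟩, ?_⟩, by linarith⟩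
  · linear_combination (3 - Real.sqrt 5) / 16 * hsq
  · rintro t ⟨ht0, -, ht⟩
    have hfactor : (t - 1) * (t ^ 2 + t - 1) = 0 := by linear_combination (-2) * ht
    rcases mul_eq_zero.mp hfactor with h | h
    · linarith
    · nlinarith
end
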